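/- arXiv:2206.05924 — 9 statements merged into one kernel-verified Lean document; each statement's English description precedes it below -/
import Mathlib

section
/- Let m ≥ 2, let α_1, …, α_m be a trellis in ℝ^{m−1}, let s_1, …, s_m be positive integers with gcd(s_1,…,s_m) = 1, set ŝ = s_1 + ⋯ + s_m and β = (1/ŝ)·∑_{i=1}^m s_i·α_i. Then every finite (𝒜,β)-mediated set B ⊆ ℝ^{m−1} satisfies |B| ≥ m − 1. -/
/-- `B` is an `A`-mediated set: every point of `B` is the average of two
distinct points of `A ∪ B`. -/
def IsMediatedSet {d : ℕ} (A : Set (Fin d → ℝ)) (B : Finset (Fin d → ℝ)) : Prop :=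
  ∀ β ∈ B, ∃ γ ∈ A ∪ ↑B, ∃ δ ∈ A ∪ ↑B, γ ≠ δ ∧ (2 : ℝ) • β = γ + δ

/-- A nonempty finite set of points contains a point that is not the midpoint of two distinct
points of the set. -/
lemma exists_not_midpoint {d : ℕ} (T : Finset (Fin d → ℝ)) (hT : T.Nonempty) :
    ∃ b ∈ T, ∀ γ ∈ T, ∀ δ ∈ T, (2 : ℝ) • b = γ + δ → γ = δ := by
  obtain ⟨b, hb, hmax⟩ := T.exists_max_image (fun x => ∑ j, x j ^ 2) hT
  refine ⟨b, hb, fun γ hγ δ hδ h => ?_⟩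
  have hj : ∀ j, 2 * b j = γ j + δ j := fun j => by simpa using congrFun h j
  have hsum : ∑ j, (γ j - δ j) ^ 2 =
      2 * (∑ j, γ j ^ 2) + 2 * (∑ j, δ j ^ 2) - 4 * ∑ j, b j ^ 2 := by
    simp only [Finset.mul_sum, ← Finset.sum_add_distrib, ← Finset.sum_sub_distrib]
    exact Finset.sum_congr rfl fun j _ => by
      linear_combination (2 * b j + (γ j + δ j)) * hj j
  have hzero : ∑ j, (γ j - δ j) ^ 2 = 0 :=
    le_antisymm (by linarith [hmax γ hγ, hmax δ hδ])
      (Finset.sum_nonneg fun j _ => sq_nonneg _)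
  rw [Finset.sum_eq_zero_iff_of_nonneg fun j _ => sq_nonneg _] at hzero
  funext j
  exact sub_eq_zero.1 (pow_eq_zero_iff two_ne_zero |>.1 (hzero j (Finset.mem_univ j)))

/-- If a finite set `U` contains a point where the affine function `f` is positive, it contains a
point that is not the midpoint of two distinct points each of which lies in `U` or has `f ≤ 0`. -/
lemma exists_not_midpoint_of_pos {d : ℕ} (U : Finset (Fin d → ℝ)) (f : (Fin d → ℝ) →ᵃ[ℝ] ℝ)
    {β : Fin d → ℝ} (hβ : β ∈ U) (hf : 0 < f β) :
    ∃ b ∈ U, ∀ γ δ, (γ ∈ U ∨ f γ ≤ 0) → (δ ∈ U ∨ f δ ≤ 0) → (2 : ℝ) • b = γ + δ → γ = δ := by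
  classical
  obtain ⟨c, hc, hmax⟩ := U.exists_max_image f ⟨β, hβ⟩
  have hcpos : 0 < f c := hf.trans_le (hmax β hβ)
  obtain ⟨b, hb, hext⟩ := exists_not_midpoint (U.filter fun x => f x = f c)
    ⟨c, Finset.mem_filter.2 ⟨hc, rfl⟩⟩
  obtain ⟨hbU, hbc⟩ := Finset.mem_filter.1 hb
  refine ⟨b, hbU, fun γ δ hγ hδ h => ?_⟩
  have hmid : 2 * f b = f γ + f δ := by
    have hl : 2 * f.linear b = f.linear γ + f.linear δ := by
      simpa using congrArg f.linear h
    have e : ∀ x, f x = f.linear x + f 0 := fun x => congrFun f.decomp x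
    rw [e b, e γ, e δ]
    linarith
  have hle : ∀ x, (x ∈ U ∨ f x ≤ 0) → f x ≤ f c := fun x hx =>
    hx.elim (hmax x) fun h0 => h0.trans hcpos.le
  have hγc : f γ = f c := by linarith [hle γ hγ, hle δ hδ]
  have hδc : f δ = f c := by linarith
  have hmem : ∀ x, (x ∈ U ∨ f x ≤ 0) → f x = f c → x ∈ U.filter fun x => f x = f c :=
    fun x hx hxc => Finset.mem_filter.2 ⟨hx.resolve_right (by linarith), hxc⟩
  exact hext γ (hmem γ hγ hγc) δ (hmem δ hδ hδc) h

/-- An affinely independent family of `m` points in `ℝ^(m-1)` has barycentric coordinates. -/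
lemma exists_barycentric_coord {m : ℕ} (hm : 2 ≤ m) (α : Fin m → (Fin (m - 1) → ℝ))
    (hα : AffineIndependent ℝ α) (i : Fin m) :
    ∃ f : (Fin (m - 1) → ℝ) →ᵃ[ℝ] ℝ, ∀ j, f (α j) = if i = j then 1 else 0 := by
  have htop : affineSpan ℝ (Set.range α) = ⊤ := by
    rw [hα.affineSpan_eq_top_iff_card_eq_finrank_add_one]
    simp only [Fintype.card_fin, Module.finrank_fin_fun]
    omega
  let b : AffineBasis (Fin m) ℝ (Fin (m - 1) → ℝ) := ⟨α, hα, htop⟩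
  exact ⟨b.coord i, fun j => b.coord_apply i j⟩

/-- An affine map commutes with weighted averages. -/
lemma affineMap_weighted_average {ι : Type*} [Fintype ι] {d : ℕ} (f : (Fin d → ℝ) →ᵃ[ℝ] ℝ)
    (α : ι → (Fin d → ℝ)) (w : ι → ℝ) (hw : ∑ i, w i ≠ 0) :
    f ((∑ i, w i)⁻¹ • ∑ i, w i • α i) = (∑ i, w i)⁻¹ * ∑ i, w i * f (α i) := by
  have e : ∀ x, f x = f.linear x + f 0 := fun x => congrFun f.decomp x
  simp only [e (α _)]
  rw [e]
  simp only [map_smul, map_sum, smul_eq_mul, mul_add, Finset.sum_add_distrib, ← Finset.sum_mul]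
  field_simp

/-- Every `(𝒜, β)`-mediated set has cardinality at least `m - 1`. -/
theorem mediated_card_ge_m_sub_one {m : ℕ} (hm : 2 ≤ m)
    (α : Fin m → (Fin (m - 1) → ℝ)) (hα : AffineIndependent ℝ α)
    (s : Fin m → ℕ) (hs : ∀ i, 0 < s i) (hgcd : Finset.univ.gcd s = 1)
    (β : Fin (m - 1) → ℝ)
    (hβ : β = ((∑ i, s i : ℕ) : ℝ)⁻¹ • ∑ i, (s i : ℝ) • α i)
    (B : Finset (Fin (m - 1) → ℝ))
    (hmed : IsMediatedSet (Set.range α) B) (hβB : β ∈ B) :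
    m - 1 ≤ B.card := by
  classical
  choose! γ hγ δ hδ hne hmid using hmed
  -- Every point reachable from `β` through the midpoint relations lies in `β + W`.
  let W : Submodule ℝ (Fin (m - 1) → ℝ) :=
    Submodule.span ℝ (B.image fun b => γ b - b : Finset (Fin (m - 1) → ℝ))
  have hdir : ∀ b ∈ B, γ b - b ∈ W := fun b hb =>
    Submodule.subset_span (Finset.mem_coe.2 (Finset.mem_image_of_mem _ hb))
  have hγW : ∀ b ∈ B, b - β ∈ W → γ b - β ∈ W := fun b hb h => by
    have := W.add_mem (hdir b hb) h
    rwa [sub_add_sub_cancel] at this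
  have hδW : ∀ b ∈ B, b - β ∈ W → δ b - β ∈ W := fun b hb h => by
    have h' := W.sub_mem h (hdir b hb)
    have e : b - β - (γ b - b) = δ b - β := by
      have := hmid b hb
      rw [two_smul] at this
      rw [eq_sub_of_add_eq' this.symm]
      abel
    rwa [e] at h'
  have hαW : ∀ i, α i - β ∈ W := by
    intro i
    by_contra hi
    obtain ⟨f, hf⟩ := exists_barycentric_coord hm α hα i
    have hspos : (0 : ℝ) < ∑ j, (s j : ℝ) :=
      Finset.sum_pos (fun j _ => Nat.cast_pos.2 (hs j)) ⟨i, Finset.mem_univ i⟩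
    have hfβ : 0 < f β := by
      rw [hβ, Nat.cast_sum, affineMap_weighted_average f α _ hspos.ne']
      simp only [hf, mul_ite, mul_one, mul_zero, Finset.sum_ite_eq, Finset.mem_univ, if_true]
      exact mul_pos (inv_pos.2 hspos) (Nat.cast_pos.2 (hs i))
    obtain ⟨b, hb, hext⟩ := exists_not_midpoint_of_pos (B.filter fun x => x - β ∈ W) f
      (Finset.mem_filter.2 ⟨hβB, by simp⟩) hfβ
    obtain ⟨hbB, hbW⟩ := Finset.mem_filter.1 hb
    have hcase : ∀ x ∈ Set.range α ∪ ↑B, x - β ∈ W →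
        x ∈ B.filter (fun x => x - β ∈ W) ∨ f x ≤ 0 := by
      rintro x (⟨j, rfl⟩ | hx) hxW
      · right
        rw [hf, if_neg]
        rintro rfl
        exact hi hxW
      · exact Or.inl (Finset.mem_filter.2 ⟨hx, hxW⟩)
    exact hne b hbB (hext _ _ (hcase _ (hγ b hbB) (hγW b hbB hbW))
      (hcase _ (hδ b hbB) (hδW b hbB hbW)) (hmid b hbB))
  have hle : vectorSpan ℝ (Set.range α) ≤ W := by
    refine Submodule.span_le.2 ?_
    rintro _ ⟨_, ⟨i, rfl⟩, _, ⟨j, rfl⟩, rfl⟩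
    have := W.sub_mem (hαW i) (hαW j)
    rwa [sub_sub_sub_cancel_right] at this
  calc m - 1 = Module.finrank ℝ (vectorSpan ℝ (Set.range α)) :=
        (hα.finrank_vectorSpan (by rw [Fintype.card_fin]; omega)).symm
    _ ≤ Module.finrank ℝ W := Submodule.finrank_mono hle
    _ ≤ (B.image fun b => γ b - b).card := finrank_span_finset_le_card _
    _ ≤ B.card := Finset.card_image_le
end

section
/- Let m ≥ 2, let α_1, …, α_m be a trellis in ℝ^{m−1}, let s_1, …, s_m be positive integers with gcd(s_1,…,s_m) = 1, set ŝ = s_1 + ⋯ + s_m and β = (1/ŝ)·∑_{i=1}^m s_i·α_i. Then every finite (𝒜,β)-mediated set B ⊆ ℝ^{m−1} satisfies |B| ≥ max{⌈log₂ ŝ⌉, m − 1}. -/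
/-- Strict convexity of the squared Euclidean norm at a midpoint. -/
lemma two_mul_dotProduct_self_lt {d : ℕ} {b γ δ : Fin d → ℝ} (hne : γ ≠ δ)
    (h : (2 : ℝ) • b = γ + δ) : 2 * (b ⬝ᵥ b) < γ ⬝ᵥ γ + δ ⬝ᵥ δ := by
  obtain ⟨j, hj⟩ := Function.ne_iff.mp hne
  have hb : ∀ i, b i = (γ i + δ i) / 2 := fun i => by
    have := congrFun h i
    simp only [Pi.smul_apply, smul_eq_mul, Pi.add_apply] at this
    linarith
  simp only [dotProduct, Finset.mul_sum, ← Finset.sum_add_distrib]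
  refine Finset.sum_lt_sum (fun i _ => ?_) ⟨j, Finset.mem_univ j, ?_⟩
  · rw [hb i]
    nlinarith [sq_nonneg (γ i - δ i)]
  · rw [hb j]
    nlinarith [sq_pos_of_ne_zero (sub_ne_zero.mpr hj)]

lemma AffineMap.sum_map_multiset {V : Type*} [AddCommGroup V] [Module ℝ V] (f : V →ᵃ[ℝ] ℝ)
    (M : Multiset V) : (M.map f).sum = f.linear M.sum + M.card * f 0 := by
  induction M using Multiset.induction_on with
  | empty => simp
  | cons a M ih =>
    have ha : f a = f.linear a + f 0 := congrFun f.decomp a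
    rw [Multiset.map_cons, Multiset.sum_cons, Multiset.sum_cons, Multiset.card_cons, ih, map_add,
      ha]
    push_cast
    ring

lemma AffineMap.two_mul_eq_of_two_smul_eq {V : Type*} [AddCommGroup V] [Module ℝ V]
    (f : V →ᵃ[ℝ] ℝ) {b γ δ : V} (h : (2 : ℝ) • b = γ + δ) : 2 * f b = f γ + f δ := by
  have hp : ∀ p, f p = f.linear p + f 0 := fun p => congrFun f.decomp p
  have hl := congrArg f.linear h
  rw [map_smul, map_add, smul_eq_mul] at hl
  rw [hp b, hp γ, hp δ]
  linarith

/-- An affine basis coordinate of a weighted average of the basis points. -/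
lemma AffineBasis.coord_weighted_average {ι V : Type*} [Fintype ι] [AddCommGroup V] [Module ℝ V]
    (e : AffineBasis ι ℝ V) (w : ι → ℝ) (hw : ∑ j, w j ≠ 0) (i : ι) :
    e.coord i ((∑ j, w j)⁻¹ • ∑ j, w j • e j) = w i / ∑ j, w j := by
  classical
  have hp : ∀ p, e.coord i p = (e.coord i).linear p + e.coord i 0 :=
    fun p => congrFun (e.coord i).decomp p
  have hl : ∀ j, (e.coord i).linear (e j) = (if i = j then 1 else 0) - e.coord i 0 := fun j => by
    rw [← e.coord_apply i j, hp (e j)]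
    ring
  rw [hp, map_smul, map_sum]
  simp only [map_smul, hl, smul_eq_mul, mul_sub, Finset.sum_sub_distrib, ← Finset.sum_mul,
    mul_ite, mul_one, mul_zero, Finset.sum_ite_eq, Finset.mem_univ, if_true]
  field_simp
  ring

/-- Any multiple `k • β` of a point of a mediated set is a sum of `k` points of `A ∪ B` in which
each point of `B` occurs at most once. -/
lemma IsMediatedSet.exists_multiset_sum_eq_nsmul {d : ℕ} {A B : Finset (Fin d → ℝ)}
    (hmed : IsMediatedSet (A : Set (Fin d → ℝ)) B) {β : Fin d → ℝ} (hβ : β ∈ B) (k : ℕ) :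
    ∃ M : Multiset (Fin d → ℝ), M.card = k ∧ (∀ p ∈ M, p ∈ A ∪ B) ∧ M.sum = k • β ∧
      ∀ b ∈ B, M.count b ≤ 1 := by
  obtain ⟨M, hM, hmax⟩ := Finset.exists_max_image
    (((A ∪ B).sym k).filter fun M : Sym (Fin d → ℝ) k => (M : Multiset (Fin d → ℝ)).sum = k • β)
    (fun M => ((M : Multiset (Fin d → ℝ)).map fun p => p ⬝ᵥ p).sum)
    ⟨Sym.replicate k β, by
      simp only [Finset.mem_filter, Finset.mem_sym_iff]
      refine ⟨fun a ha => ?_, by simp [Sym.coe_replicate]⟩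
      rw [(Sym.mem_replicate.mp ha).2]
      exact Finset.mem_union_right _ hβ⟩
  obtain ⟨hMmem, hMsum⟩ := Finset.mem_filter.mp hM
  rw [Finset.mem_sym_iff] at hMmem
  refine ⟨M, M.2, hMmem, hMsum, fun b hb => ?_⟩
  by_contra! hcount
  obtain ⟨γ, hγ, δ, hδ, hne, hmid⟩ := hmed b hb
  obtain ⟨R, hR⟩ : ∃ R, (M : Multiset (Fin d → ℝ)) = Multiset.replicate 2 b + R :=
    Multiset.le_iff_exists_add.mp (Multiset.le_count_iff_replicate_le.mp hcount)
  have hRcard : (({γ, δ} : Multiset (Fin d → ℝ)) + R).card = k := by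
    have := M.2
    change (M : Multiset (Fin d → ℝ)).card = k at this
    rw [hR] at this
    simpa using this
  have hlt := two_mul_dotProduct_self_lt hne hmid
  have hle := hmax (Sym.mk ({γ, δ} + R) hRcard) <| by
    refine Finset.mem_filter.mpr ⟨Finset.mem_sym_iff.mpr fun a ha => ?_, ?_⟩
    · rcases Multiset.mem_add.mp ha with ha | ha
      · simp only [Multiset.insert_eq_cons, Multiset.mem_cons, Multiset.mem_singleton] at ha
        rcases ha with rfl | rfl
        · simpa using hγ
        · simpa using hδ
      · refine hMmem a ?_
        rw [← Sym.mem_coe, hR]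
        exact Multiset.mem_add.mpr (Or.inr ha)
    · rw [← hMsum, hR, Sym.coe_mk]
      rw [two_smul] at hmid
      simp [← add_assoc, hmid]
  simp only [Sym.coe_mk, hR, Multiset.map_add, Multiset.sum_add, Multiset.map_replicate,
    Multiset.sum_replicate, Multiset.insert_eq_cons, Multiset.map_cons, Multiset.map_singleton,
    Multiset.sum_cons, Multiset.sum_singleton, nsmul_eq_mul, Nat.cast_ofNat] at hle
  linarith

/-- The denominator of the barycentric coordinates of a point of a mediated set is at most
`2 ^ #B`. -/
lemma IsMediatedSet.sum_le_two_pow_card {d : ℕ} {ι : Type*} [Fintype ι]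
    (e : AffineBasis ι ℝ (Fin d → ℝ)) (s : ι → ℕ) (hgcd : Finset.univ.gcd s = 1)
    (hpos : 0 < ∑ i, s i) {B : Finset (Fin d → ℝ)} (hmed : IsMediatedSet (Set.range e) B)
    {β : Fin d → ℝ} (hβ : β ∈ B) (hcoord : ∀ i, e.coord i β = s i / (∑ j, s j : ℕ)) :
    ∑ i, s i ≤ 2 ^ B.card := by
  classical
  have hA : ((Finset.univ.image e : Finset (Fin d → ℝ)) : Set (Fin d → ℝ)) = Set.range e := by
    simp
  choose M hcard hmem hsum hcount using
    IsMediatedSet.exists_multiset_sum_eq_nsmul (hA ▸ hmed) hβ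
  have hnodup : ∀ k, ((M k).filter (· ∈ B)).Nodup := fun k => by
    rw [Multiset.nodup_iff_count_le_one]
    intro a
    rw [Multiset.count_filter]
    split_ifs with ha
    · exact hcount k a ha
    · exact zero_le_one
  have hint : ∀ k i, ∃ z : ℕ, (((M k).filter (· ∉ B)).map (e.coord i)).sum = z := fun k i => by
    have : ∀ R : Multiset (Fin d → ℝ), (∀ p ∈ R, p ∈ Set.range e) →
        ∃ z : ℕ, (R.map (e.coord i)).sum = z := fun R => by
      induction R using Multiset.induction_on with
      | empty => exact fun _ => ⟨0, by simp⟩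
      | cons a R ih =>
        intro h
        obtain ⟨z, hz⟩ := ih fun p hp => h p (Multiset.mem_cons_of_mem hp)
        obtain ⟨j, rfl⟩ := h a (Multiset.mem_cons_self a R)
        refine ⟨(if i = j then 1 else 0) + z, ?_⟩
        rw [Multiset.map_cons, Multiset.sum_cons, hz, e.coord_apply]
        push_cast
        rfl
    refine this _ fun p hp => ?_
    obtain ⟨hp, hpB⟩ := Multiset.mem_filter.mp hp
    simpa [hpB] using hmem k p hp
  have hval : ∀ k i, (((M k).filter (· ∈ B)).map (e.coord i)).sum +
      (((M k).filter (· ∉ B)).map (e.coord i)).sum = k * (s i / (∑ j, s j : ℕ)) := fun k i => by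
    have hp : e.coord i β = (e.coord i).linear β + e.coord i 0 := congrFun (e.coord i).decomp β
    rw [← Multiset.sum_add, ← Multiset.map_add, Multiset.filter_add_not,
      AffineMap.sum_map_multiset, hsum, hcard, map_nsmul, ← hcoord, hp, nsmul_eq_mul]
    ring
  have hS : ((∑ j, s j : ℕ) : ℝ) ≠ 0 := by exact_mod_cast hpos.ne'
  have hinj : Set.InjOn (fun k => ((M k).filter (· ∈ B)).toFinset)
      (Finset.range (∑ i, s i) : Set ℕ) := by
    intro k hk l hl hkl
    have heq := Multiset.Nodup.toFinset_inj (hnodup k) (hnodup l) hkl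
    have hdvd : ∀ i, (∑ j, s j) ∣ ((k : ℤ) - l).natAbs * s i := fun i => by
      obtain ⟨y, hy⟩ := hint k i
      obtain ⟨z, hz⟩ := hint l i
      have h1 := hval k i
      have h2 := hval l i
      rw [heq, hy] at h1
      rw [hz] at h2
      have h3 : ((k : ℝ) - l) * s i = (∑ j, s j : ℕ) * ((y : ℝ) - z) := by
        have : ((k : ℝ) - l) * (s i / (∑ j, s j : ℕ)) = y - z := by linarith
        rw [← this]
        field_simp
      have h4 : ((k : ℤ) - l) * s i = (∑ j, s j : ℕ) * ((y : ℤ) - z) := by exact_mod_cast h3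
      have h5 := congrArg Int.natAbs h4
      rw [Int.natAbs_mul, Int.natAbs_mul, Int.natAbs_natCast, Int.natAbs_natCast] at h5
      exact ⟨_, h5⟩
    have hd : (∑ j, s j) ∣ ((k : ℤ) - l).natAbs := by
      have := Finset.dvd_gcd (s := Finset.univ) fun i _ => hdvd i
      rwa [Finset.gcd_mul_left, hgcd, mul_one, normalize_eq] at this
    have hk' := Finset.mem_range.mp (Finset.mem_coe.mp hk)
    have hl' := Finset.mem_range.mp (Finset.mem_coe.mp hl)
    have := Nat.eq_zero_of_dvd_of_lt hd (by omega)
    omega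
  have := Finset.card_le_card_of_injOn (t := B.powerset) _ (fun k _ => by
    rw [Finset.mem_coe, Finset.mem_powerset]
    intro p hp
    exact (Multiset.mem_filter.mp (Multiset.mem_toFinset.mp hp)).2) hinj
  rwa [Finset.card_range, Finset.card_powerset] at this

/-- If `β` in a mediated set has positive `i`-th barycentric coordinate, then every subset of
`A ∪ B` that contains `β` and is closed under passing to the two averaged points contains the
`i`-th vertex. -/
lemma AffineBasis.mem_of_mediated_closed {d : ℕ} {ι : Type*}
    (e : AffineBasis ι ℝ (Fin d → ℝ)) {B : Finset (Fin d → ℝ)} {S : Set (Fin d → ℝ)}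
    (hS : ∀ b ∈ B, b ∈ S → ∃ γ ∈ Set.range e ∪ ↑B, ∃ δ ∈ Set.range e ∪ ↑B,
      γ ∈ S ∧ δ ∈ S ∧ γ ≠ δ ∧ (2 : ℝ) • b = γ + δ)
    {β : Fin d → ℝ} (hβ : β ∈ B) (hβS : β ∈ S) {i : ι} (hi : 0 < e.coord i β) : e i ∈ S := by
  classical
  by_contra hiS
  obtain ⟨b, hb, hmax⟩ := Finset.exists_max_image (B.filter (· ∈ S))
    (fun p => toLex (e.coord i p, p ⬝ᵥ p)) ⟨β, Finset.mem_filter.mpr ⟨hβ, hβS⟩⟩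
  obtain ⟨hbB, hbS⟩ := Finset.mem_filter.mp hb
  have hlex : ∀ p ∈ B, p ∈ S → e.coord i p < e.coord i b ∨
      e.coord i p = e.coord i b ∧ p ⬝ᵥ p ≤ b ⬝ᵥ b := fun p hp hpS => by
    simpa [Prod.Lex.toLex_le_toLex] using hmax p (Finset.mem_filter.mpr ⟨hp, hpS⟩)
  have hbpos : 0 < e.coord i b := by
    rcases hlex β hβ hβS with h | h
    · exact hi.trans h
    · exact h.1 ▸ hi
  have hall : ∀ p ∈ Set.range e ∪ ↑B, p ∈ S → e.coord i p < e.coord i b ∨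
      e.coord i p = e.coord i b ∧ p ⬝ᵥ p ≤ b ⬝ᵥ b := by
    rintro p (⟨j, rfl⟩ | hp) hpS
    · left
      rwa [e.coord_apply_ne]
      rintro rfl
      exact hiS hpS
    · exact hlex p hp hpS
  obtain ⟨γ, hγ, δ, hδ, hγS, hδS, hne, hmid⟩ := hS b hbB hbS
  have hlt := two_mul_dotProduct_self_lt hne hmid
  have hc := (e.coord i).two_mul_eq_of_two_smul_eq hmid
  rcases hall γ hγ hγS with h | h <;> rcases hall δ hδ hδS with h' | h' <;> linarith [h, h']

/-- A mediated set containing a point of the interior of the simplex has at least as many points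
as the dimension of the simplex. -/
lemma IsMediatedSet.dim_le_card {d : ℕ} {ι : Type*}
    (e : AffineBasis ι ℝ (Fin d → ℝ)) {B : Finset (Fin d → ℝ)}
    (hmed : IsMediatedSet (Set.range e) B) {β : Fin d → ℝ} (hβ : β ∈ B)
    (hpos : ∀ i, 0 < e.coord i β) : d ≤ B.card := by
  classical
  choose! γ hγ δ hδ hne hmid using hmed
  set W := Submodule.span ℝ (B.image fun b => γ b - δ b : Set (Fin d → ℝ))
  have hdiff : ∀ b ∈ B, γ b - δ b ∈ W := fun b hb =>
    Submodule.subset_span (Finset.mem_coe.mpr (Finset.mem_image_of_mem _ hb))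
  have hvert : ∀ i, e i - β ∈ W := fun i => by
    refine e.mem_of_mediated_closed (S := {p | p - β ∈ W}) (fun b hb hbS => ?_) hβ
      (by simp) (hpos i)
    have hbW : b - β ∈ W := hbS
    have hbeq : b = (2 : ℝ)⁻¹ • (γ b + δ b) := by
      rw [← hmid b hb, smul_smul]
      norm_num
    refine ⟨γ b, hγ b hb, δ b, hδ b hb, ?_, ?_, hne b hb, hmid b hb⟩
    · have : γ b - β = (b - β) + (2 : ℝ)⁻¹ • (γ b - δ b) := by
        nth_rewrite 2 [hbeq]
        module
      change γ b - β ∈ W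
      rw [this]
      exact W.add_mem hbW (W.smul_mem _ (hdiff b hb))
    · have : δ b - β = (b - β) - (2 : ℝ)⁻¹ • (γ b - δ b) := by
        nth_rewrite 2 [hbeq]
        module
      change δ b - β ∈ W
      rw [this]
      exact W.sub_mem hbW (W.smul_mem _ (hdiff b hb))
  have htop : W = ⊤ := by
    rw [eq_top_iff, ← AffineSubspace.direction_top ℝ (Fin d → ℝ) (Fin d → ℝ), ← e.tot,
      direction_affineSpan, vectorSpan_def, Submodule.span_le]
    rintro _ ⟨_, ⟨i, rfl⟩, _, ⟨j, rfl⟩, rfl⟩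
    have := W.sub_mem (hvert i) (hvert j)
    rwa [sub_sub_sub_cancel_right] at this
  calc d = Module.finrank ℝ W := by rw [htop, finrank_top, Module.finrank_fin_fun]
    _ ≤ (B.image fun b => γ b - δ b).card := finrank_span_finset_le_card _
    _ ≤ B.card := Finset.card_image_le

/-- Every `(𝒜, β)`-mediated set has cardinality at least `max {⌈log₂ ŝ⌉, m - 1}`. -/
theorem mediated_card_ge_max {m : ℕ} (hm : 2 ≤ m)
    (α : Fin m → (Fin (m - 1) → ℝ)) (hα : AffineIndependent ℝ α)
    (s : Fin m → ℕ) (hs : ∀ i, 0 < s i) (hgcd : Finset.univ.gcd s = 1)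
    (β : Fin (m - 1) → ℝ)
    (hβ : β = ((∑ i, s i : ℕ) : ℝ)⁻¹ • ∑ i, (s i : ℝ) • α i)
    (B : Finset (Fin (m - 1) → ℝ))
    (hmed : IsMediatedSet (Set.range α) B) (hβB : β ∈ B) :
    max (Nat.clog 2 (∑ i, s i)) (m - 1) ≤ B.card := by
  let e : AffineBasis (Fin m) ℝ (Fin (m - 1) → ℝ) :=
    ⟨α, hα, hα.affineSpan_eq_top_iff_card_eq_finrank_add_one.mpr (by
      rw [Fintype.card_fin, Module.finrank_fin_fun]
      omega)⟩
  have hpos : 0 < ∑ i, s i :=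
    Finset.sum_pos (fun i _ => hs i) ⟨⟨0, by omega⟩, Finset.mem_univ _⟩
  have hcoord : ∀ i, e.coord i β = s i / (∑ j, s j : ℕ) := fun i => by
    have hne : ∑ j, (s j : ℝ) ≠ 0 := by exact_mod_cast hpos.ne'
    rw [hβ, Nat.cast_sum]
    exact e.coord_weighted_average (fun j => (s j : ℝ)) hne i
  refine max_le (Nat.clog_le_of_le_pow ?_) ?_
  · exact IsMediatedSet.sum_le_two_pow_card e s hgcd hpos hmed hβB hcoord
  · refine IsMediatedSet.dim_le_card e hmed hβB fun i => ?_
    rw [hcoord]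
    exact div_pos (Nat.cast_pos.mpr (hs i)) (Nat.cast_pos.mpr hpos)
end

section
/- For all integers p, q with 0 < q < p and gcd(p,q) = 1, there exists a (p,q)-mediated sequence A ⊆ ℕ with |A| ≤ ⌈log₂ p⌉. -/
/-- `A` is a `p`-mediated sequence: every element of `A` is the average of two
distinct elements of `A ∪ {0, p}`. -/
def IsMediatedSeq (p : ℕ) (A : Finset ℕ) : Prop :=
  ∀ a ∈ A, ∃ b ∈ A ∪ ({0, p} : Finset ℕ), ∃ c ∈ A ∪ ({0, p} : Finset ℕ),
    b ≠ c ∧ 2 * a = b + c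

/-- Let `q` be the barycentre of three integer points `x, y, z` whose weights `a, b, c` have sum
`2 ^ k`, with `a` odd, and suppose that the differences of the points have no common divisor.
Then `q` is `x` or lies in a set of at most `k` integers, each of which is the midpoint of two
distinct elements of this set together with `x, y, z`. -/
theorem exists_midpoint_closed_of_barycentre (q k : ℕ) : ∀ x y z a b c : ℕ,
    Odd a → a + b + c = 2 ^ k → a * x + b * y + c * z = 2 ^ k * q →
    (∀ d : ℤ, d ∣ (x : ℤ) - y → d ∣ (y : ℤ) - z → d ∣ 1) →
    ∃ B : Finset ℕ, B.card ≤ k ∧ q ∈ insert x B ∧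
      ∀ m ∈ B, ∃ u ∈ B ∪ {x, y, z}, ∃ v ∈ B ∪ {x, y, z}, u ≠ v ∧ 2 * m = u + v := by
  induction k with
  | zero =>
    intro x y z a b c ha hsum hbar _
    have ha1 : 1 ≤ a := ha.pos
    obtain rfl : a = 1 := by omega
    obtain rfl : b = 0 := by omega
    obtain rfl : c = 0 := by omega
    exact ⟨∅, by simp, by simp; omega, by simp⟩
  | succ k ih =>
    -- By symmetry in `y` and `z` we may assume that the second odd weight is that of `y`.
    have key : ∀ x y z a b c : ℕ, Odd a → Odd b → a + b + c = 2 ^ (k + 1) →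
        a * x + b * y + c * z = 2 ^ (k + 1) * q →
        (∀ d : ℤ, d ∣ (x : ℤ) - y → d ∣ (y : ℤ) - z → d ∣ 1) →
        ∃ B : Finset ℕ, B.card ≤ k + 1 ∧ q ∈ insert x B ∧
          ∀ m ∈ B, ∃ u ∈ B ∪ {x, y, z}, ∃ v ∈ B ∪ {x, y, z}, u ≠ v ∧ 2 * m = u + v := by
      intro x y z a b c ha hb hsum hbar hgcd
      obtain ⟨c, rfl⟩ : ∃ c', c = 2 * c' := by
        obtain ⟨i, rfl⟩ := ha
        obtain ⟨j, rfl⟩ := hb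
        exact ⟨2 ^ k - i - j - 1, by rw [pow_succ] at hsum; omega⟩
      by_cases hxy : x = y
      · -- Then `z` is adjacent to `x`, so the integer `q` between them has to be `x`.
        subst hxy
        refine ⟨∅, by simp, ?_, by simp⟩
        have hz : (x : ℤ) - z ∣ 1 := hgcd _ (by simp) dvd_rfl
        have ha1 := ha.pos
        have hlin : ((a : ℤ) + b) * (x - q) + 2 * c * (z - q) = 0 := by
          zify at hsum hbar
          linear_combination hbar - (q : ℤ) * hsum
        have hcases : (x : ℤ) - z = 1 ∨ (x : ℤ) - z = -1 :=
          Int.isUnit_iff.mp (isUnit_of_dvd_one hz)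
        simp only [Finset.mem_insert, Finset.notMem_empty, or_false]
        by_contra hne
        have hab : (0 : ℤ) < a + b := by omega
        have hc : (0 : ℤ) ≤ 2 * c := by omega
        rcases lt_or_gt_of_ne hne with h | h
        · have h1 : (1 : ℤ) ≤ x - q := by omega
          have h2 : (0 : ℤ) ≤ z - q := by omega
          nlinarith [mul_nonneg hc h2]
        · have h1 : (1 : ℤ) ≤ q - x := by omega
          have h2 : (0 : ℤ) ≤ q - z := by omega
          nlinarith [mul_nonneg hc h2]
      · obtain ⟨m, hm⟩ : ∃ m, 2 * m = x + y := by
          have heven : Even (a * x + b * y + 2 * c * z) := by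
            rw [hbar, pow_succ]
            exact ⟨2 ^ k * q, by ring⟩
          have : Even (x + y) := by
            simpa [Nat.even_add, Nat.even_mul, Nat.not_even_iff_odd.mpr ha,
              Nat.not_even_iff_odd.mpr hb] using heven
          obtain ⟨m, hm⟩ := this
          exact ⟨m, by omega⟩
        have hmZ : (2 : ℤ) * m = x + y := by exact_mod_cast hm
        -- It suffices to reach `q` from `m`, `z` and one of `x`, `y`.
        have extend : ∀ w, w = x ∨ w = y → (∃ B : Finset ℕ, B.card ≤ k ∧ q ∈ insert m B ∧
            ∀ e ∈ B, ∃ u ∈ B ∪ {m, w, z}, ∃ v ∈ B ∪ {m, w, z}, u ≠ v ∧ 2 * e = u + v) →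
            ∃ B : Finset ℕ, B.card ≤ k + 1 ∧ q ∈ insert x B ∧
              ∀ m ∈ B, ∃ u ∈ B ∪ {x, y, z}, ∃ v ∈ B ∪ {x, y, z}, u ≠ v ∧ 2 * m = u + v := by
          rintro w hw ⟨B, hcard, hqB, hB⟩
          have hsub : B ∪ {m, w, z} ⊆ insert m B ∪ {x, y, z} := by
            intro t
            simp only [Finset.mem_union, Finset.mem_insert, Finset.mem_singleton]
            rcases hw with rfl | rfl <;> tauto
          refine ⟨insert m B, (Finset.card_insert_le _ _).trans (by omega),
            Finset.mem_insert_of_mem hqB, fun e he => ?_⟩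
          rcases Finset.mem_insert.mp he with rfl | he
          · exact ⟨x, by simp, y, by simp, hxy, hm⟩
          · obtain ⟨u, hu, v, hv, huv⟩ := hB e he
            exact ⟨u, hsub hu, v, hsub hv, huv⟩
        rcases le_total a b with hab | hab
        · obtain ⟨t, ht⟩ := Nat.Odd.sub_odd hb ha
          obtain rfl : b = a + 2 * t := by omega
          refine extend y (Or.inr rfl) (ih m y z a t c ha ?_ ?_ fun d h1 h2 => hgcd d ?_ h2)
          · rw [pow_succ] at hsum; omega
          · rw [pow_succ] at hbar
            have : a * (2 * m) = a * (x + y) := by rw [hm]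
            linarith
          · have := h1.mul_left 2
            rwa [show (2 : ℤ) * (m - y) = x - y by linarith] at this
        · obtain ⟨t, ht⟩ := Nat.Odd.sub_odd ha hb
          obtain rfl : a = b + 2 * t := by omega
          refine extend x (Or.inl rfl) (ih m x z b t c hb ?_ ?_ fun d h1 h2 => ?_)
          · rw [pow_succ] at hsum; omega
          · rw [pow_succ] at hbar
            have : b * (2 * m) = b * (x + y) := by rw [hm]
            linarith
          · have h3 : d ∣ (y : ℤ) - x := by
              have := h1.mul_left 2
              rwa [show (2 : ℤ) * (m - x) = y - x by linarith] at this
            exact hgcd d (dvd_sub_comm.mp h3) (by simpa using dvd_add h3 h2)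
    intro x y z a b c ha hsum hbar hgcd
    rcases Nat.even_or_odd b with hb | hb
    · have hc : Odd c := by
        obtain ⟨i, rfl⟩ := ha
        obtain ⟨j, rfl⟩ := hb
        exact ⟨2 ^ k - i - j - 1, by rw [pow_succ] at hsum; omega⟩
      obtain ⟨B, hB⟩ := key x z y a c b ha hc (by omega) (by omega) fun d h1 h2 =>
        hgcd d (by simpa using dvd_add h1 h2) (dvd_sub_comm.mp h2)
      exact ⟨B, by rwa [Finset.pair_comm z y] at hB⟩
    · exact key x y z a b c ha hb hsum hbar hgcd

/-- For `0 < q < p` coprime, there exists a `(p, q)`-mediated sequence of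
cardinality at most `⌈log₂ p⌉`. -/
theorem exists_mediatedSeq_card_le_clog (p q : ℕ) (hq : 0 < q) (hqp : q < p)
    (hgcd : Nat.gcd p q = 1) :
    ∃ A : Finset ℕ, IsMediatedSeq p A ∧ q ∈ A ∧ A.card ≤ Nat.clog 2 p := by
  have hp : p ≤ 2 ^ Nat.clog 2 p := Nat.le_pow_clog one_lt_two p
  obtain ⟨c, hc⟩ := Nat.exists_eq_add_of_le hp
  obtain ⟨r, rfl⟩ := Nat.exists_eq_add_of_lt hqp
  set p := q + r + 1 with hpdef
  have hdvd : ∀ d : ℤ, d ∣ (p : ℤ) → d ∣ (q : ℤ) → d ∣ 1 := fun d h1 h2 => by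
    have := Int.dvd_coe_gcd h1 h2
    rwa [Int.gcd_natCast_natCast, hgcd] at this
  have hbar : q * p + (r + 1) * 0 + c * q = 2 ^ Nat.clog 2 p * q := by rw [hc]; ring
  suffices h : ∃ B : Finset ℕ, B.card ≤ Nat.clog 2 p ∧ q ∈ B ∧
      ∀ m ∈ B, ∃ u ∈ B ∪ {0, p, q}, ∃ v ∈ B ∪ {0, p, q}, u ≠ v ∧ 2 * m = u + v by
    obtain ⟨B, hcard, hqB, hB⟩ := h
    have hB' : B ∪ {0, p, q} = B ∪ {0, p} := by
      ext t
      simp only [Finset.mem_union, Finset.mem_insert, Finset.mem_singleton]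
      constructor
      · rintro (h | h | h | rfl) <;> tauto
      · tauto
    rw [hB'] at hB
    exact ⟨B, hB, hqB, hcard⟩
  rcases Nat.even_or_odd q with hqe | hqo
  · have hr : Odd (r + 1) := by
      by_contra hr
      rw [Nat.not_odd_iff_even] at hr
      have h2 : 2 ∣ Nat.gcd p q :=
        Nat.dvd_gcd (by rw [hpdef, add_assoc]; exact (hqe.add hr).two_dvd) hqe.two_dvd
      omega
    obtain ⟨B, hcard, hqB, hB⟩ := exists_midpoint_closed_of_barycentre q (Nat.clog 2 p)
      0 p q (r + 1) q c hr (by omega) (by omega) fun d h1 h2 => by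
        have h3 : d ∣ (p : ℤ) := by simpa using h1
        exact hdvd d h3 (by simpa using dvd_sub h3 h2)
    exact ⟨B, hcard, (Finset.mem_insert.mp hqB).resolve_left (by omega), hB⟩
  · obtain ⟨B, hcard, hqB, hB⟩ := exists_midpoint_closed_of_barycentre q (Nat.clog 2 p)
      p 0 q q (r + 1) c hqo (by omega) hbar fun d h1 h2 =>
        hdvd d (by simpa using h1) (by simpa using h2)
    rw [Finset.insert_comm p 0] at hB
    exact ⟨B, hcard, (Finset.mem_insert.mp hqB).resolve_left (by omega), hB⟩
end

section
/- For all integers p, q with 0 < q < p and gcd(p,q) = 1, every (p,q)-mediated sequence A ⊆ ℕ satisfies |A| ≥ ⌈log₂ p⌉. -/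
/-- Modulo `p`, the sum of a multiset of elements of `A ∪ {0, p}` is the sum of a subset of `A`.
As long as some `a ∈ A` is repeated, two copies of `a` are replaced by the two distinct elements
of which `a` is the average; this terminates because the sum of squares increases. -/
theorem IsMediatedSeq.exists_subset_sum_eq {p : ℕ} {A : Finset ℕ} (hA : IsMediatedSeq p A)
    (s : Multiset ℕ) (hs : ∀ x ∈ s, x ∈ A ∪ ({0, p} : Finset ℕ)) :
    ∃ T ⊆ A, ((∑ x ∈ T, x : ℕ) : ZMod p) = (s.sum : ZMod p) := by
  obtain ⟨M, hM⟩ : ∃ M, ∀ x ∈ A ∪ ({0, p} : Finset ℕ), x ^ 2 ≤ M :=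
    ⟨_, fun x hx => Finset.le_sup (f := fun x => x ^ 2) hx⟩
  have sum_sq_le : ∀ t : Multiset ℕ, (∀ x ∈ t, x ∈ A ∪ ({0, p} : Finset ℕ)) →
      (t.map (· ^ 2)).sum ≤ t.card * M := by
    intro t ht
    have h := Multiset.sum_le_card_nsmul (t.map (· ^ 2)) M (by
      intro y hy
      obtain ⟨x, hx, rfl⟩ := Multiset.mem_map.1 hy
      exact hM x (ht x hx))
    simpa using h
  induction hn : s.card * M - (s.map (· ^ 2)).sum using Nat.strong_induction_on
    generalizing s with
  | _ n ih =>
  by_cases hnd : (s.filter (· ∈ A)).Nodup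
  · refine ⟨⟨s.filter (· ∈ A), hnd⟩, fun x hx => (Multiset.mem_filter.1 hx).2, ?_⟩
    have hdvd : p ∣ (s.filter (¬ · ∈ A)).sum := by
      refine Multiset.dvd_sum fun x hx => ?_
      obtain ⟨hxs, hxA⟩ := Multiset.mem_filter.1 hx
      have hx' := hs x hxs
      simp only [Finset.mem_union, hxA, Finset.mem_insert, Finset.mem_singleton,
        false_or] at hx'
      rcases hx' with rfl | rfl <;> simp
    conv_rhs => rw [← Multiset.filter_add_not (· ∈ A) s, Multiset.sum_add, Nat.cast_add,
      (ZMod.natCast_eq_zero_iff _ p).2 hdvd, add_zero]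
    simp [Finset.sum]
  · rw [Multiset.nodup_iff_le] at hnd
    push Not at hnd
    obtain ⟨a, ha⟩ := hnd
    have haA : a ∈ A := (Multiset.mem_filter.1 (Multiset.mem_of_le ha (by simp))).2
    obtain ⟨t, rfl⟩ := Multiset.le_iff_exists_add.1 (ha.trans (Multiset.filter_le _ _))
    obtain ⟨b, hb, c, hc, hbc, habc⟩ := hA a haA
    have hs' : ∀ x ∈ b ::ₘ c ::ₘ t, x ∈ A ∪ ({0, p} : Finset ℕ) := by
      intro x hx
      rcases Multiset.mem_cons.1 hx with rfl | hx
      · exact hb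
      rcases Multiset.mem_cons.1 hx with rfl | hx
      · exact hc
      exact hs x (Multiset.mem_add.2 (Or.inr hx))
    have hlt : a ^ 2 + a ^ 2 < b ^ 2 + c ^ 2 := by
      zify at hbc habc ⊢
      have := sq_pos_of_ne_zero (sub_ne_zero.2 hbc)
      nlinarith
    have hle := sum_sq_le _ hs'
    obtain ⟨T, hTA, hT⟩ := ih _ (by
      rw [← hn]
      simp only [Multiset.cons_add, zero_add, Multiset.map_cons, Multiset.sum_cons,
        Multiset.card_cons] at hle ⊢
      omega) (b ::ₘ c ::ₘ t) hs' rfl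
    refine ⟨T, hTA, hT.trans (congrArg _ ?_)⟩
    simp
    omega

/-- For `0 < q < p` coprime, every `(p, q)`-mediated sequence has cardinality
at least `⌈log₂ p⌉`. -/
theorem mediatedSeq_card_ge_clog (p q : ℕ) (hq : 0 < q) (hqp : q < p)
    (hgcd : Nat.gcd p q = 1) (A : Finset ℕ) (hA : IsMediatedSeq p A) (hqA : q ∈ A) :
    Nat.clog 2 p ≤ A.card := by
  have : NeZero p := ⟨by omega⟩
  refine Nat.clog_le_of_le_pow ?_
  have hsurj : (Finset.univ : Finset (ZMod p)) ⊆
      A.powerset.image fun T => ((∑ x ∈ T, x : ℕ) : ZMod p) := by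
    intro z _
    obtain ⟨T, hTA, hT⟩ := hA.exists_subset_sum_eq
      (Multiset.replicate (z * (q : ZMod p)⁻¹).val q) (by
        intro x hx
        rw [Multiset.eq_of_mem_replicate hx]
        exact Finset.mem_union_left _ hqA)
    refine Finset.mem_image.2 ⟨T, Finset.mem_powerset.2 hTA, hT.trans ?_⟩
    have hinv := ZMod.coe_mul_inv_eq_one q (Nat.coprime_comm.1 hgcd)
    simp only [Multiset.sum_replicate, smul_eq_mul, Nat.cast_mul, ZMod.natCast_val,
      ZMod.cast_id', id_eq]
    rw [mul_assoc, mul_comm _ (q : ZMod p), hinv, mul_one]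
  calc p = (Finset.univ : Finset (ZMod p)).card := by rw [Finset.card_univ, ZMod.card]
    _ ≤ _ := Finset.card_le_card hsurj
    _ ≤ A.powerset.card := Finset.card_image_le
    _ = 2 ^ A.card := Finset.card_powerset A
end

section
/- For all integers p, q with 0 < q < p and gcd(p,q) = 1, the minimum cardinality of a (p,q)-mediated sequence equals ⌈log₂ p⌉; that is, ⌈log₂ p⌉ is the least element of the set {n ∈ ℕ : there exists a (p,q)-mediated sequence A with |A| = n}. Equivalently, L(q, p−q) = ⌈log₂ p⌉, where L(q, p−q) is the minimum size of a second-order cone representation of the bivariate weighted geometric mean inequality x_1^q x_2^{p−q} ≥ x_3^p. -/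
/-- Every element of a `p`-mediated sequence is at most `p`. -/
lemma IsMediatedSeq.le {p : ℕ} {A : Finset ℕ} (hA : IsMediatedSeq p A) {a : ℕ} (ha : a ∈ A) :
    a ≤ p := by
  obtain ⟨m, hm, hmax⟩ := A.exists_max_image id ⟨a, ha⟩
  obtain ⟨b, hb, c, hc, hbc, h⟩ := hA m hm
  simp only [Finset.mem_union, Finset.mem_insert, Finset.mem_singleton, id] at hb hc hmax
  have hb' : b ≤ m ∨ b ≤ p := by
    rcases hb with hb | hb | hb
    · exact Or.inl (hmax b hb)
    all_goals lia
  have hc' : c ≤ m ∨ c ≤ p := by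
    rcases hc with hc | hc | hc
    · exact Or.inl (hmax c hc)
    all_goals lia
  have := hmax a ha
  lia

/-- Replacing two copies of a midpoint by the two distinct endpoints decreases the
strictly concave potential `x * (p - x)`. -/
lemma potential_add_lt_two_mul_midpoint {p a b c : ℕ} (ha : a ≤ p) (hb : b ≤ p) (hc : c ≤ p)
    (hbc : b ≠ c) (h : 2 * a = b + c) :
    b * (p - b) + c * (p - c) < a * (p - a) + a * (p - a) := by
  zify [ha, hb, hc] at *
  have hpos : 0 < ((b : ℤ) - c) ^ 2 := by
    have : (b : ℤ) - c ≠ 0 := sub_ne_zero.mpr hbc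
    positivity
  have hcc : (c : ℤ) = 2 * a - b := by linarith
  rw [hcc] at hpos ⊢
  nlinarith

/-- The sum of a multiset drawn from `A ∪ {0, p}` agrees modulo `p` with a subset sum of `A`. -/
lemma IsMediatedSeq.exists_subset_sum_modEq {p : ℕ} {A : Finset ℕ} (hA : IsMediatedSeq p A)
    (s : Multiset ℕ) (hs : ∀ x ∈ s, x ∈ A ∪ ({0, p} : Finset ℕ)) :
    ∃ T ⊆ A, (∑ x ∈ T, x) ≡ s.sum [MOD p] := by
  induction hN : (s.map fun x => x * (p - x)).sum using Nat.strong_induction_on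
    generalizing s with
  | _ N ih =>
  have hle : ∀ x ∈ A ∪ ({0, p} : Finset ℕ), x ≤ p := by
    intro x hx
    simp only [Finset.mem_union, Finset.mem_insert, Finset.mem_singleton] at hx
    rcases hx with hx | rfl | rfl
    exacts [hA.le hx, Nat.zero_le _, le_rfl]
  by_cases hdup : (s.filter (· ∈ A)).Nodup
  · refine ⟨⟨s.filter (· ∈ A), hdup⟩, fun x hx => (Multiset.mem_filter.mp hx).2, ?_⟩
    have hsplit := congrArg Multiset.sum (Multiset.filter_add_not (· ∈ A) s)
    rw [Multiset.sum_add] at hsplit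
    have hdvd : p ∣ (s.filter (¬ · ∈ A)).sum := by
      refine Multiset.dvd_sum fun x hx => ?_
      obtain ⟨hxs, hxA⟩ := Multiset.mem_filter.mp hx
      have := hs x hxs
      simp only [Finset.mem_union, Finset.mem_insert, Finset.mem_singleton, hxA,
        false_or] at this
      rcases this with rfl | rfl
      exacts [dvd_zero _, dvd_rfl]
    have hsum : (∑ x ∈ (⟨s.filter (· ∈ A), hdup⟩ : Finset ℕ), x) = (s.filter (· ∈ A)).sum := by
      simp [Finset.sum]
    rw [hsum, ← hsplit]
    simpa using (Nat.ModEq.refl (s.filter (· ∈ A)).sum).add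
      (Nat.modEq_zero_iff_dvd.mpr hdvd).symm
  · rw [Multiset.nodup_iff_le] at hdup
    push Not at hdup
    obtain ⟨a, ha⟩ := hdup
    have haA : a ∈ A := (Multiset.mem_filter.mp (Multiset.mem_of_le ha (by simp))).2
    obtain ⟨t, rfl⟩ := Multiset.le_iff_exists_add.mp (ha.trans (Multiset.filter_le _ _))
    obtain ⟨b, hb, c, hc, hbc, h⟩ := hA a haA
    have hlt := potential_add_lt_two_mul_midpoint (hA.le haA) (hle b hb) (hle c hc) hbc h
    obtain ⟨T, hT, hsum⟩ := ih _ (by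
      rw [← hN]
      simp only [Multiset.cons_add, Multiset.zero_add,
        Multiset.map_cons, Multiset.sum_cons]
      lia) (b ::ₘ c ::ₘ t) (by
        intro x hx
        simp only [Multiset.mem_cons] at hx
        rcases hx with rfl | rfl | hx
        exacts [hb, hc, hs x (Multiset.mem_add.mpr (Or.inr hx))]) rfl
    refine ⟨T, hT, ?_⟩
    have heq : (b ::ₘ c ::ₘ t).sum = (a ::ₘ {a} + t).sum := by
      simp only [Multiset.cons_add, Multiset.singleton_add, Multiset.sum_cons]
      lia
    rwa [heq] at hsum

/-- A `p`-mediated sequence containing an element coprime to `p` has at least `log₂ p` elements: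
its subset sums cover all residues modulo `p`. -/
lemma IsMediatedSeq.le_two_pow_card {p q : ℕ} {A : Finset ℕ} (hA : IsMediatedSeq p A)
    (hqA : q ∈ A) (hp : 0 < p) (hgcd : Nat.gcd p q = 1) : p ≤ 2 ^ A.card := by
  have : NeZero p := ⟨hp.ne'⟩
  have hsurj : (Finset.univ : Finset (ZMod p)) ⊆
      A.powerset.image fun T => ((∑ x ∈ T, x : ℕ) : ZMod p) := by
    intro r _
    obtain ⟨T, hT, hsum⟩ := hA.exists_subset_sum_modEq
      (Multiset.replicate (r * (q : ZMod p)⁻¹).val q) (by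
        intro x hx
        rw [Multiset.eq_of_mem_replicate hx]
        exact Finset.mem_union_left _ hqA)
    refine Finset.mem_image.mpr ⟨T, Finset.mem_powerset.mpr hT, ?_⟩
    rw [(ZMod.natCast_eq_natCast_iff _ _ _).mpr hsum, Multiset.sum_replicate, smul_eq_mul,
      Nat.cast_mul, ZMod.natCast_zmod_val, mul_assoc, mul_comm _ (q : ZMod p),
      ZMod.coe_mul_inv_eq_one q (Nat.Coprime.symm hgcd), mul_one]
  calc p = (Finset.univ : Finset (ZMod p)).card := by rw [Finset.card_univ, ZMod.card]
    _ ≤ _ := Finset.card_le_card hsurj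
    _ ≤ A.powerset.card := Finset.card_image_le
    _ = 2 ^ A.card := Finset.card_powerset A

/-- `B` has at most `m` elements, contains `q`, and each of its elements is the average of two
distinct elements of `B ∪ {u, v, w}`. -/
def IsMediatedOver (q m u v w : ℕ) (B : Finset ℕ) : Prop :=
  B.card ≤ m ∧ q ∈ B ∧ ∀ x ∈ B, ∃ b ∈ B ∪ ({u, v, w} : Finset ℕ),
    ∃ c ∈ B ∪ ({u, v, w} : Finset ℕ), b ≠ c ∧ 2 * x = b + c

lemma IsMediatedOver.swap {q m u v w : ℕ} {B : Finset ℕ} (h : IsMediatedOver q m u v w B) :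
    IsMediatedOver q m v u w B := by
  rwa [IsMediatedOver, Finset.insert_comm]

lemma IsMediatedOver.rotate {q m u v w : ℕ} {B : Finset ℕ} (h : IsMediatedOver q m u v w B) :
    IsMediatedOver q m v w u B := by
  rwa [IsMediatedOver, show ({v, w, u} : Finset ℕ) = {u, v, w} by ext; simp; tauto]

lemma IsMediatedOver.mono {q m n u v w : ℕ} {B : Finset ℕ} (h : IsMediatedOver q m u v w B)
    (hmn : m ≤ n) : IsMediatedOver q n u v w B :=
  ⟨h.1.trans hmn, h.2⟩

/-- A set mediated over `u, y, w`, where `y` is the midpoint of `u ≠ v`, becomes mediated over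
`u, v, w` once `y` is added to it. -/
lemma IsMediatedOver.insert_midpoint {q m u v w y : ℕ} {B : Finset ℕ}
    (h : IsMediatedOver q m u y w B) (huv : u ≠ v) (hy : 2 * y = u + v) :
    IsMediatedOver q (m + 1) u v w (insert y B) := by
  obtain ⟨hcard, hqB, hB⟩ := h
  refine ⟨(Finset.card_insert_le _ _).trans (by lia), Finset.mem_insert_of_mem hqB, ?_⟩
  have hsub : B ∪ ({u, y, w} : Finset ℕ) ⊆ insert y B ∪ {u, v, w} := by
    intro x
    simp only [Finset.mem_union, Finset.mem_insert, Finset.mem_singleton]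
    tauto
  intro x hx
  rcases Finset.mem_insert.mp hx with rfl | hx
  · exact ⟨u, by simp, v, by simp, huv, hy⟩
  · obtain ⟨b, hb, c, hc, hbc⟩ := hB x hx
    exact ⟨b, hsub hb, c, hsub hc, hbc⟩

/-- If `q` is the mean of `u, v, w` with nonnegative integer weights of sum `2 ^ m`, not all of
the weight being at `q` itself, then at most `m` midpoints suffice to construct `q`. -/
lemma exists_isMediatedOver {q m u v w a b c : ℕ} (hsum : a + b + c = 2 ^ m)
    (hmean : a * u + b * v + c * w = 2 ^ m * q)
    (hne : (0 < a ∧ u ≠ q) ∨ (0 < b ∧ v ≠ q) ∨ (0 < c ∧ w ≠ q)) :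
    ∃ B, IsMediatedOver q m u v w B := by
  induction m generalizing u v w a b c with
  | zero =>
    exfalso
    have : (a = 1 ∧ b = 0 ∧ c = 0) ∨ (a = 0 ∧ b = 1 ∧ c = 0) ∨ (a = 0 ∧ b = 0 ∧ c = 1) := by
      lia
    rcases this with ⟨rfl, rfl, rfl⟩ | ⟨rfl, rfl, rfl⟩ | ⟨rfl, rfl, rfl⟩ <;> simp_all
  | succ m ih =>
    have step : ∀ {u v w i j k : ℕ}, (2 * i + j) + j + 2 * k = 2 ^ (m + 1) → Odd j →
        (2 * i + j) * u + j * v + 2 * k * w = 2 ^ (m + 1) * q →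
        ((0 < 2 * i + j ∧ u ≠ q) ∨ (0 < j ∧ v ≠ q) ∨ (0 < 2 * k ∧ w ≠ q)) →
        ∃ B, IsMediatedOver q (m + 1) u v w B := by
      intro u v w i j k hsum hj hmean hne
      obtain ⟨y, hy⟩ : ∃ y, 2 * y = u + v := by
        have heven : Even (j * (u + v)) := by
          have h : Even ((j * (u + v)) + 2 * (i * u + k * w)) :=
            ⟨2 ^ m * q, by rw [pow_succ] at hmean; linarith⟩
          exact (Nat.even_add.mp h).mpr (even_two_mul _)
        obtain ⟨y, hy⟩ := (Nat.even_mul.mp heven).resolve_left (Nat.not_even_iff_odd.mpr hj)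
        exact ⟨y, by lia⟩
      have hj0 : 0 < j := hj.pos
      have hsum' : i + j + k = 2 ^ m := by rw [pow_succ] at hsum; lia
      have hmean' : i * u + j * y + k * w = 2 ^ m * q := by
        have : j * (2 * y) = j * (u + v) := by rw [hy]
        rw [pow_succ] at hmean
        linarith
      by_cases huv : u = v
      · obtain rfl : y = v := by lia
        obtain ⟨B, hB⟩ := ih hsum' hmean' (by
          rcases hne with h | h | h
          · exact Or.inr (Or.inl ⟨hj0, huv ▸ h.2⟩)
          · exact Or.inr (Or.inl h)
          · exact Or.inr (Or.inr ⟨by lia, h.2⟩))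
        exact ⟨B, hB.mono (Nat.le_succ m)⟩
      by_cases hyq : y = q
      · subst hyq
        refine ⟨{y}, by simp, by simp, fun x hx => ?_⟩
        rw [Finset.mem_singleton.mp hx]
        exact ⟨u, by simp, v, by simp, huv, hy⟩
      · obtain ⟨B, hB⟩ := ih hsum' hmean' (Or.inr (Or.inl ⟨hj0, hyq⟩))
        exact ⟨_, hB.insert_midpoint huv hy⟩
    have step_of_odd : ∀ {u v w a b c : ℕ}, Odd a → Odd b → a + b + c = 2 ^ (m + 1) →
        a * u + b * v + c * w = 2 ^ (m + 1) * q →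
        ((0 < a ∧ u ≠ q) ∨ (0 < b ∧ v ≠ q) ∨ (0 < c ∧ w ≠ q)) →
        ∃ B, IsMediatedOver q (m + 1) u v w B := by
      intro u v w a b c ha hb hsum hmean hne
      obtain ⟨k, rfl⟩ : ∃ k, c = 2 * k := by
        rw [pow_succ] at hsum
        obtain ⟨r, rfl⟩ := ha
        obtain ⟨s, rfl⟩ := hb
        exact ⟨2 ^ m - r - s - 1, by lia⟩
      rcases le_total b a with hba | hab
      · obtain ⟨i, rfl⟩ : ∃ i, a = 2 * i + b := by
          obtain ⟨r, rfl⟩ := ha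
          obtain ⟨s, rfl⟩ := hb
          exact ⟨r - s, by lia⟩
        exact step hsum hb hmean hne
      · obtain ⟨i, rfl⟩ : ∃ i, b = 2 * i + a := by
          obtain ⟨r, rfl⟩ := ha
          obtain ⟨s, rfl⟩ := hb
          exact ⟨s - r, by lia⟩
        obtain ⟨B, hB⟩ := step (u := v) (v := u) (w := w) (i := i) (k := k) (by lia) ha
          (by linarith) (by tauto)
        exact ⟨B, hB.swap⟩
    rcases Nat.even_or_odd a with ha | ha <;> rcases Nat.even_or_odd b with hb | hb
    · obtain ⟨i, rfl⟩ := ha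
      obtain ⟨j, rfl⟩ := hb
      obtain ⟨k, rfl⟩ : ∃ k, c = k + k := ⟨2 ^ m - i - j, by rw [pow_succ] at hsum; lia⟩
      rw [pow_succ] at hsum hmean
      obtain ⟨B, hB⟩ := ih (u := u) (v := v) (w := w) (a := i) (b := j) (c := k)
        (by lia) (by linarith) (by
          rcases hne with h | h | h
          · exact Or.inl ⟨by lia, h.2⟩
          · exact Or.inr (Or.inl ⟨by lia, h.2⟩)
          · exact Or.inr (Or.inr ⟨by lia, h.2⟩))
      exact ⟨B, hB.mono (Nat.le_succ m)⟩
    · have hc : Odd c := by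
        rw [pow_succ] at hsum
        rw [Nat.odd_iff] at *
        rw [Nat.even_iff] at ha
        lia
      obtain ⟨B, hB⟩ := step_of_odd (u := v) (v := w) (w := u) hb hc (c := a)
        (by lia) (by linarith) (by tauto)
      exact ⟨B, hB.rotate.rotate⟩
    · have hc : Odd c := by
        rw [pow_succ] at hsum
        rw [Nat.odd_iff] at *
        rw [Nat.even_iff] at hb
        lia
      obtain ⟨B, hB⟩ := step_of_odd (u := w) (v := u) (w := v) hc ha (c := b)
        (by lia) (by linarith) (by tauto)
      exact ⟨B, hB.rotate⟩
    · exact step_of_odd ha hb hsum hmean hne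

/-- There is a `(p, q)`-mediated sequence with at most `n` elements whenever `p ≤ 2 ^ n`. -/
lemma exists_isMediatedSeq_card_le {p q n : ℕ} (hq : 0 < q) (hqp : q < p) (hn : p ≤ 2 ^ n) :
    ∃ A, IsMediatedSeq p A ∧ q ∈ A ∧ A.card ≤ n := by
  obtain ⟨B, hcard, hqB, hB⟩ := exists_isMediatedOver (q := q) (m := n) (u := 0) (v := p) (w := q)
    (a := p - q) (b := q) (c := 2 ^ n - p) (by lia)
    (by zify [hn]; ring) (Or.inl ⟨by lia, hq.ne⟩)
  refine ⟨B, ?_, hqB, hcard⟩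
  have hpool : B ∪ ({0, p, q} : Finset ℕ) = B ∪ {0, p} := by
    ext x
    simp only [Finset.mem_union, Finset.mem_insert, Finset.mem_singleton]
    constructor
    · rintro (h | h | h | rfl) <;> tauto
    · tauto
  rwa [hpool] at hB

/-- For `0 < q < p` coprime, the minimum cardinality of a `(p, q)`-mediated sequence
is exactly `⌈log₂ p⌉`: equivalently, `L(q, p - q) = ⌈log₂ p⌉`. -/
theorem minimum_mediatedSeq_card_eq_clog (p q : ℕ) (hq : 0 < q) (hqp : q < p)
    (hgcd : Nat.gcd p q = 1) :
    IsLeast {n : ℕ | ∃ A : Finset ℕ, IsMediatedSeq p A ∧ q ∈ A ∧ A.card = n}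
      (Nat.clog 2 p) := by
  have lower {A : Finset ℕ} (hA : IsMediatedSeq p A) (hqA : q ∈ A) : Nat.clog 2 p ≤ A.card :=
    Nat.clog_le_of_le_pow (hA.le_two_pow_card hqA (hq.trans hqp) hgcd)
  refine ⟨?_, ?_⟩
  · obtain ⟨A, hA, hqA, hcard⟩ :=
      exists_isMediatedSeq_card_le hq hqp (Nat.le_pow_clog one_lt_two p)
    exact ⟨A, hA, hqA, hcard.antisymm (lower hA hqA)⟩
  · rintro n ⟨A, hA, hqA, rfl⟩
    exact lower hA hqA
end

section
/- Let α_1, α_2, α_3 be a trellis in ℝ² (three affinely independent points), let s_1, s_2, s_3 be positive integers with gcd(s_1,s_2,s_3) = 1 and s_1 + s_2 + s_3 = 2^l for some natural number l, and set β = 2^{−l}·(s_1·α_1 + s_2·α_2 + s_3·α_3). Then the minimum cardinality of an (𝒜,β)-mediated set equals l; that is, l is the least element of {n ∈ ℕ : there exists an (𝒜,β)-mediated set B with |B| = n}. Equivalently, L(s_1,s_2,s_3) = l. -/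
/-- A dyadic point of a nondegenerate triangle with denominator `2 ^ l` is reached by repeatedly
bisecting, at most `l` times, the edge between the two vertices of odd weight. -/
theorem exists_isMediatedSet_card_le {d : ℕ} (l : ℕ) :
    ∀ (x y z : Fin d → ℝ) (a b c : ℕ) (T : Set (Fin d → ℝ)),
      (∀ u v w : ℝ, u + v + w = 0 → u • x + v • y + w • z = 0 → u = 0 ∧ v = 0 ∧ w = 0) →
      x ∈ T → y ∈ T → z ∈ T → a + b + c = 2 ^ l → (Odd a ∨ Odd b ∨ Odd c) →
      ∃ B : Finset (Fin d → ℝ), B.card ≤ l ∧ IsMediatedSet T B ∧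
        ∃ p ∈ T ∪ ↑B, (2 : ℝ) ^ l • p = (a : ℝ) • x + (b : ℝ) • y + (c : ℝ) • z := by
  classical
  induction l with
  | zero =>
    intro x y z a b c T _ hx hy hz hsum _
    refine ⟨∅, by simp, by simp [IsMediatedSet], ?_⟩
    have h : (a = 1 ∧ b = 0 ∧ c = 0) ∨ (a = 0 ∧ b = 1 ∧ c = 0) ∨ (a = 0 ∧ b = 0 ∧ c = 1) := by
      rw [pow_zero] at hsum
      omega
    rcases h with ⟨rfl, rfl, rfl⟩ | ⟨rfl, rfl, rfl⟩ | ⟨rfl, rfl, rfl⟩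
    · exact ⟨x, by simp [hx], by simp⟩
    · exact ⟨y, by simp [hy], by simp⟩
    · exact ⟨z, by simp [hz], by simp⟩
  | succ l ih =>
    have bisect : ∀ (x y z : Fin d → ℝ) (a b c : ℕ) (T : Set (Fin d → ℝ)),
        (∀ u v w : ℝ, u + v + w = 0 → u • x + v • y + w • z = 0 → u = 0 ∧ v = 0 ∧ w = 0) →
        x ∈ T → y ∈ T → z ∈ T → a + b + c = 2 ^ (l + 1) → Odd a → Odd b → b ≤ a →
        ∃ B : Finset (Fin d → ℝ), B.card ≤ l + 1 ∧ IsMediatedSet T B ∧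
          ∃ p ∈ T ∪ ↑B,
            (2 : ℝ) ^ (l + 1) • p = (a : ℝ) • x + (b : ℝ) • y + (c : ℝ) • z := by
      intro x y z a b c T hind hx hy hz hsum ha hb hab
      rw [pow_succ] at hsum
      obtain ⟨e, he⟩ : ∃ e, a = b + 2 * e := by
        obtain ⟨e, he⟩ := Nat.Odd.sub_odd ha hb
        exact ⟨e, by omega⟩
      obtain ⟨g, hg⟩ : ∃ g, c = 2 * g := by
        obtain ⟨i, hi⟩ := hb
        exact ⟨2 ^ l - b - e, by omega⟩
      subst he hg
      set m : Fin d → ℝ := (1 / 2 : ℝ) • (x + y) with hm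
      obtain ⟨B, hcard, hB, p, hp, hpe⟩ := ih x m z e b g (insert m T)
        (by
          intro u v w h0 h1
          have := hind (u + v / 2) (v / 2) w (by linarith) (by rw [← h1, hm]; module)
          refine ⟨?_, ?_, ?_⟩ <;> linarith [this.1, this.2.1, this.2.2])
        (by simp [hx]) (by simp) (by simp [hz]) (by omega) (by tauto)
      have hunion : T ∪ ↑(insert m B) = insert m T ∪ (↑B : Set (Fin d → ℝ)) := by
        ext q
        simp only [Finset.coe_insert, Set.mem_union, Set.mem_insert_iff]
        tauto
      refine ⟨insert m B, (Finset.card_insert_le _ _).trans (by omega), ?_, p, ?_, ?_⟩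
      · intro q hq
        rcases Finset.mem_insert.1 hq with rfl | hq
        · refine ⟨x, by simp [hx], y, by simp [hy], ?_, by rw [hm]; module⟩
          rintro rfl
          have := hind 1 (-1) 0 (by norm_num) (by module)
          norm_num at this
        · rw [hunion]
          exact hB q hq
      · rw [hunion]
        exact hp
      · rw [pow_succ, mul_comm, mul_smul, hpe, hm]
        push_cast
        module
    have symm : ∀ (x y z : Fin d → ℝ) (a b c : ℕ) (T : Set (Fin d → ℝ)),
        (∀ u v w : ℝ, u + v + w = 0 → u • x + v • y + w • z = 0 → u = 0 ∧ v = 0 ∧ w = 0) →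
        x ∈ T → y ∈ T → z ∈ T → a + b + c = 2 ^ (l + 1) → Odd a → Odd b →
        ∃ B : Finset (Fin d → ℝ), B.card ≤ l + 1 ∧ IsMediatedSet T B ∧
          ∃ p ∈ T ∪ ↑B,
            (2 : ℝ) ^ (l + 1) • p = (a : ℝ) • x + (b : ℝ) • y + (c : ℝ) • z := by
      intro x y z a b c T hind hx hy hz hsum ha hb
      rcases le_total b a with h | h
      · exact bisect x y z a b c T hind hx hy hz hsum ha hb h
      · rw [add_comm ((a : ℝ) • x)]
        refine bisect y x z b a c T (fun u v w h0 h1 => ?_) hy hx hz (by omega) hb ha h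
        have := hind v u w (by linarith) (by rw [← h1]; module)
        tauto
    intro x y z a b c T hind hx hy hz hsum hodd
    by_cases ha : Odd a
    · by_cases hb : Odd b
      · exact symm x y z a b c T hind hx hy hz hsum ha hb
      · rw [add_right_comm ((a : ℝ) • x)]
        refine symm x z y a c b T (fun u v w h0 h1 => ?_) hx hz hy (by omega) ha ?_
        · have := hind u w v (by linarith) (by rw [← h1]; module)
          tauto
        · rw [pow_succ] at hsum
          simp only [Nat.odd_iff] at *
          omega
    · have hbc : Odd b ∧ Odd c := by
        rw [pow_succ] at hsum
        simp only [Nat.odd_iff] at *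
        omega
      rw [add_assoc, add_comm ((a : ℝ) • x)]
      refine symm y z x b c a T (fun u v w h0 h1 => ?_) hy hz hx (by omega) hbc.1 hbc.2
      have := hind w u v (by linarith) (by rw [← h1]; module)
      tauto

/-- Replacing a pair of equal points of a mediated set by the two distinct points they average
increases the sum of squares, so among all multisets of `k` points with sum `k • β` at least one
repeats no point of `B`. -/
theorem IsMediatedSet.exists_multiset {d : ℕ} {A B : Finset (Fin d → ℝ)}
    (hB : IsMediatedSet (A : Set (Fin d → ℝ)) B) {β : Fin d → ℝ} (hβ : β ∈ B) (k : ℕ) :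
    ∃ M : Multiset (Fin d → ℝ), (∀ x ∈ M, x ∈ A ∪ B) ∧ M.card = k ∧ M.sum = k • β ∧
      ∀ b ∈ B, M.count b ≤ 1 := by
  classical
  let energy : Multiset (Fin d → ℝ) → ℝ := fun M => (M.map fun x => x ⬝ᵥ x).sum
  have hne : (((A ∪ B).sym k).filter
      fun M : Sym (Fin d → ℝ) k => (M : Multiset (Fin d → ℝ)).sum = k • β).Nonempty := by
    refine ⟨Sym.replicate k β, ?_⟩
    simp only [Finset.mem_filter, Finset.mem_sym_iff, Sym.mem_replicate, Sym.coe_replicate,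
      Multiset.sum_replicate, and_true]
    rintro a ⟨-, rfl⟩
    exact Finset.mem_union_right _ hβ
  obtain ⟨M, hM, hmax⟩ := Finset.exists_max_image _
    (fun M : Sym (Fin d → ℝ) k => energy M) hne
  simp only [Finset.mem_filter, Finset.mem_sym_iff] at hM hmax
  refine ⟨M, hM.1, M.2, hM.2, fun b hb => ?_⟩
  by_contra! hcount
  obtain ⟨N, hN⟩ := Multiset.le_iff_exists_add.1 (Multiset.le_count_iff_replicate_le.1 hcount)
  obtain ⟨γ, hγ, δ, hδ, hne, hmid⟩ := hB b hb
  rw [← Finset.coe_union, Finset.mem_coe] at hγ hδ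
  have hcard : (γ ::ₘ δ ::ₘ N).card = k := by
    have := congrArg Multiset.card hN
    rw [show (M : Multiset (Fin d → ℝ)).card = k from M.2] at this
    simp at this ⊢
    omega
  have hlt := hmax ⟨γ ::ₘ δ ::ₘ N, hcard⟩ ⟨?_, ?_⟩
  · have hpos : 0 < (γ - δ) ⬝ᵥ (γ - δ) := by
      refine lt_of_le_of_ne (Finset.sum_nonneg fun i _ => mul_self_nonneg _) fun h => hne ?_
      exact sub_eq_zero.1 (dotProduct_self_eq_zero.1 h.symm)
    have hsq := congrArg (fun v => v ⬝ᵥ v) hmid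
    simp only [energy, hN, Sym.coe_mk, Multiset.map_cons, Multiset.sum_cons, Multiset.map_add,
      Multiset.sum_add, Multiset.map_replicate, Multiset.sum_replicate, two_nsmul] at hlt
    simp only [smul_dotProduct, dotProduct_smul, add_dotProduct, dotProduct_add, smul_eq_mul,
      sub_dotProduct, dotProduct_sub] at hsq hpos
    linarith
  · intro x hx
    have hx : x ∈ γ ::ₘ δ ::ₘ N := hx
    simp only [Multiset.mem_cons] at hx
    rcases hx with rfl | rfl | hx
    · exact hγ
    · exact hδ
    · refine hM.1 x ?_
      rw [← Sym.mem_coe, hN]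
      exact Multiset.mem_add.2 (Or.inr hx)
  · rw [← hM.2, hN]
    simp only [Sym.coe_mk, Multiset.sum_cons, Multiset.sum_add, Multiset.sum_replicate]
    rw [← add_assoc, ← hmid, two_smul, two_nsmul]

/-- Every multiple of a point of a mediated set is a subset sum modulo the lattice of the
trellis. -/
theorem IsMediatedSet.exists_subset_sum {d : ℕ} {ι : Type*} [Fintype ι] {α : ι → Fin d → ℝ}
    (hα : Function.Injective α) {B : Finset (Fin d → ℝ)}
    (hB : IsMediatedSet (Set.range α) B) {β : Fin d → ℝ} (hβ : β ∈ B) (k : ℕ) :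
    ∃ S ⊆ B, ∃ f : ι → ℕ, ∑ i, f i + S.card = k ∧
      (k : ℝ) • β = ∑ i, (f i : ℝ) • α i + ∑ x ∈ S, x := by
  classical
  have hrange : Set.range α = (Finset.univ.image α : Finset (Fin d → ℝ)) := by simp
  rw [hrange] at hB
  obtain ⟨M, hM, hcard, hsum, hcount⟩ := hB.exists_multiset hβ k
  set A := Finset.univ.image α with hA
  have hsub : M.toFinset ⊆ A ∪ (B \ A) := by
    intro x hx
    rw [Finset.union_sdiff_self_eq_union]
    exact hM x (Multiset.mem_toFinset.1 hx)
  have hone : ∀ x ∈ B \ A, M.count x = if M.count x = 1 then 1 else 0 := by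
    intro x hx
    have := hcount x (Finset.mem_sdiff.1 hx).1
    split_ifs <;> omega
  refine ⟨(B \ A).filter fun x => M.count x = 1,
    (Finset.filter_subset _ _).trans Finset.sdiff_subset, fun i => M.count (α i), ?_, ?_⟩
  · rw [← hcard, ← Multiset.sum_count_eq_card (s := A ∪ (B \ A))
      (fun a ha => hsub (Multiset.mem_toFinset.2 ha)), Finset.sum_union Finset.disjoint_sdiff,
      hA, Finset.sum_image hα.injOn, ← hA, Finset.sum_congr rfl hone, Finset.card_filter]
  · rw [Nat.cast_smul_eq_nsmul, ← hsum, Finset.sum_multiset_count_of_subset M _ hsub,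
      Finset.sum_union Finset.disjoint_sdiff, hA, Finset.sum_image hα.injOn, ← hA,
      Finset.sum_filter]
    congr 1
    · exact Finset.sum_congr rfl fun i _ => (Nat.cast_smul_eq_nsmul ℝ _ _).symm
    · refine Finset.sum_congr rfl fun x hx => ?_
      have := hone x hx
      split_ifs at this ⊢ <;> simp [this]

/-- A point with reduced barycentric denominator `2 ^ l` lies in no mediated set with fewer than
`l` points. -/
theorem IsMediatedSet.le_card {d : ℕ} {ι : Type*} [Fintype ι] {α : ι → Fin d → ℝ}
    (hα : AffineIndependent ℝ α) {s : ι → ℕ} {j : ι} (hj : Odd (s j)) {l : ℕ}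
    (hsum : ∑ i, s i = 2 ^ l) {β : Fin d → ℝ}
    (hβ : (2 : ℝ) ^ l • β = ∑ i, (s i : ℝ) • α i) {B : Finset (Fin d → ℝ)}
    (hB : IsMediatedSet (Set.range α) B) (hmem : β ∈ B) : l ≤ B.card := by
  classical
  choose S hS f hf hfβ using hB.exists_subset_sum hα.injective hmem
  have hinj : Set.InjOn S (Finset.range (2 ^ l) : Set ℕ) := by
    intro k hk k' hk' hkk
    simp only [Finset.coe_range, Set.mem_Iio] at hk hk'
    have hcoef := affineIndependent_iff.1 hα Finset.univ
      (fun i => ((k : ℝ) - k') * s i - 2 ^ l * ((f k i : ℝ) - f k' i))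
      (by
        have h1 : (∑ i, (f k i : ℝ)) + (S k).card = k := by exact_mod_cast hf k
        have h2 : (∑ i, (f k' i : ℝ)) + (S k').card = k' := by exact_mod_cast hf k'
        have h3 : ∑ i, (s i : ℝ) = 2 ^ l := by exact_mod_cast hsum
        rw [hkk] at h1
        rw [Finset.sum_sub_distrib, ← Finset.mul_sum, ← Finset.mul_sum, Finset.sum_sub_distrib,
          h3, ← h1, ← h2]
        ring)
      (by
        have h1 := hfβ k
        have h2 := hfβ k'
        rw [hkk] at h1
        have h3 : ((k : ℝ) - k') • β = ∑ i, (f k i : ℝ) • α i - ∑ i, (f k' i : ℝ) • α i := by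
          rw [sub_smul, h1, h2]
          abel
        simp only [sub_smul, mul_smul, Finset.sum_sub_distrib, ← Finset.smul_sum, ← hβ]
        rw [← h3]
        module)
      j (Finset.mem_univ j)
    have hz : ((k : ℤ) - k') * s j = 2 ^ l * ((f k j : ℤ) - f k' j) := by
      exact_mod_cast sub_eq_zero.1 hcoef
    have hcop : IsCoprime ((2 : ℤ) ^ l) (s j) := by
      refine IsCoprime.pow_left ?_
      have := (Nat.coprime_two_left.2 hj).isCoprime
      exact_mod_cast this
    have hdvd : ((2 : ℤ) ^ l) ∣ (k : ℤ) - k' := hcop.dvd_of_dvd_mul_right ⟨_, hz⟩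
    have hk : (k : ℤ) < 2 ^ l := by exact_mod_cast hk
    have hk' : (k' : ℤ) < 2 ^ l := by exact_mod_cast hk'
    have := Int.eq_zero_of_abs_lt_dvd hdvd (by rw [abs_lt]; constructor <;> linarith)
    omega
  have hle := Finset.card_le_card_of_injOn S (t := B.powerset)
    (fun k _ => Finset.mem_coe.2 (Finset.mem_powerset.2 (hS k))) hinj
  rw [Finset.card_range, Finset.card_powerset] at hle
  exact (Nat.pow_le_pow_iff_right (by norm_num)).1 hle

/-- If `s₁ + s₂ + s₃ = 2 ^ l` with `gcd(s₁, s₂, s₃) = 1`, then the minimum cardinality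
of an `(𝒜, β)`-mediated set equals `l`; that is, `L(s₁, s₂, s₃) = l`. -/
theorem minimum_mediated_card_eq_of_sum_pow_two
    (α : Fin 3 → (Fin 2 → ℝ)) (hα : AffineIndependent ℝ α)
    (s : Fin 3 → ℕ) (hs : ∀ i, 0 < s i) (hgcd : Finset.univ.gcd s = 1)
    (l : ℕ) (hsum : ∑ i, s i = 2 ^ l)
    (β : Fin 2 → ℝ)
    (hβ : β = ((2 : ℝ) ^ l)⁻¹ • ∑ i, (s i : ℝ) • α i) :
    IsLeast {n : ℕ | ∃ B : Finset (Fin 2 → ℝ),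
      IsMediatedSet (Set.range α) B ∧ β ∈ B ∧ B.card = n} l := by
  have hβ' : (2 : ℝ) ^ l • β = ∑ i, (s i : ℝ) • α i := by
    rw [hβ, smul_inv_smul₀ (by positivity)]
  obtain ⟨j, hj⟩ : ∃ j, Odd (s j) := by
    by_contra! h
    have : 2 ∣ Finset.univ.gcd s :=
      Finset.dvd_gcd fun i _ => even_iff_two_dvd.1 (Nat.not_odd_iff_even.1 (h i))
    rw [hgcd] at this
    omega
  refine ⟨?_, ?_⟩
  · obtain ⟨B, hcard, hB, p, hp, hpe⟩ := exists_isMediatedSet_card_le l (α 0) (α 1) (α 2)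
      (s 0) (s 1) (s 2) (Set.range α)
      (by
        intro u v w h0 h1
        have := affineIndependent_iff.1 hα Finset.univ ![u, v, w]
          (by simpa [Fin.sum_univ_three] using h0) (by simpa [Fin.sum_univ_three] using h1)
        exact ⟨this 0 (by simp), this 1 (by simp), this 2 (by simp)⟩)
      ⟨0, rfl⟩ ⟨1, rfl⟩ ⟨2, rfl⟩ (by rw [← hsum, Fin.sum_univ_three])
      (by fin_cases j <;> simp_all)
    obtain rfl : p = β := by
      rw [← Fin.sum_univ_three (fun i => (s i : ℝ) • α i), ← hβ'] at hpe
      exact smul_right_injective _ (by positivity : (2 : ℝ) ^ l ≠ 0) hpe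
    have hpB : p ∈ B := by
      refine hp.resolve_left ?_
      rintro ⟨i, rfl⟩
      have hcoef := affineIndependent_iff.1 hα Finset.univ
        (fun k => (s k : ℝ) - if k = i then 2 ^ l else 0)
        (by
          have h3 : ∑ i, (s i : ℝ) = 2 ^ l := by exact_mod_cast hsum
          simp [h3])
        (by simp [sub_smul, ite_smul, ← hβ'])
      obtain ⟨k, hk⟩ : ∃ k, k ≠ i := exists_ne i
      have := hcoef k (Finset.mem_univ k)
      simp only [hk, if_false, sub_zero, Nat.cast_eq_zero] at this
      exact (hs k).ne' this
    exact ⟨B, hB, hpB, hcard.antisymm (hB.le_card hα hj hsum hβ' hpB)⟩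
  · rintro n ⟨B, hB, hmem, rfl⟩
    exact hB.le_card hα hj hsum hβ' hmem
end

section
/- Let m ≥ 2, let α_1, …, α_m be a trellis in ℝ^{m−1}, let s_1, …, s_m be positive integers with gcd(s_1,…,s_m) = 1, set ŝ = s_1 + ⋯ + s_m, l = ⌈log₂ ŝ⌉, and β = (1/ŝ)·∑_{i=1}^m s_i·α_i. Then there exists a finite (𝒜,β)-mediated set B ⊆ ℝ^{m−1} with |B| ≤ ∑_{i=1}^m ω(s_i) + ω(2^l − ŝ) − 1, where ω(r) denotes the number of ones in the binary expansion of the natural number r (so ω(0) = 0). In particular L(s_1,…,s_m) ≤ ∑_{i=1}^m ω(s_i) + ω(2^l − ŝ) − 1. -/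
/-- `binaryWeight r` is the number of ones in the binary expansion of `r`. -/
def binaryWeight (r : ℕ) : ℕ := (Nat.digits 2 r).count 1

theorem exists_multiset_card_eq_binaryWeight (n : ℕ) :
    ∃ E : Multiset ℕ, E.card = binaryWeight n ∧ (E.map (2 ^ ·)).sum = n := by
  induction n using Nat.strong_induction_on with
  | _ n ih =>
    rcases Nat.eq_zero_or_pos n with rfl | hn
    · exact ⟨0, by simp [binaryWeight], by simp⟩
    · obtain ⟨E, hcard, hsum⟩ := ih (n / 2) (by omega)
      have hdouble : ((E.map (· + 1)).map (2 ^ ·)).sum = 2 * (n / 2) := by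
        rw [Multiset.map_map, ← hsum, ← Multiset.sum_map_mul_left]
        simp [pow_succ, mul_comm]
      have hweight : binaryWeight n = binaryWeight (n / 2) + if n % 2 = 1 then 1 else 0 := by
        unfold binaryWeight
        rw [Nat.digits_def' one_lt_two hn, List.count_cons]
        simp
      rcases Nat.mod_two_eq_zero_or_one n with h | h
      · refine ⟨E.map (· + 1), ?_, ?_⟩
        · simp [hweight, h, hcard]
        · rw [hdouble]; omega
      · refine ⟨0 ::ₘ E.map (· + 1), ?_, ?_⟩
        · simp [hweight, h, hcard]
        · rw [Multiset.map_cons, Multiset.sum_cons, hdouble, pow_zero]; omega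

theorem exists_eq_cons_cons_of_sum_two_pow {E : Multiset ℕ} {l : ℕ}
    (hsum : (E.map (2 ^ ·)).sum = 2 ^ l) (hcard : E.card ≠ 1) :
    ∃ e t, E = e ::ₘ e ::ₘ t := by
  by_contra! h
  have hnodup : E.Nodup := Multiset.nodup_iff_ne_cons_cons.2 h
  have hE : (⟨E, hnodup⟩ : Finset ℕ) = {l} := by
    apply Finset.geomSum_injective (le_refl 2)
    simpa [Finset.sum] using hsum
  apply hcard
  have := congrArg Finset.card hE
  simpa using this

/-- Repeatedly replacing two points of equal dyadic weight by their midpoint produces a mediated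
set containing the barycenter, unless all the points coincide with it. -/
theorem exists_mediated_of_dyadic_weights {d : ℕ} (l : ℕ) (b : Fin d → ℝ) (n : ℕ)
    (M : Multiset ((Fin d → ℝ) × ℕ)) (hn : M.card = n)
    (hsum : (M.map fun x => 2 ^ x.2).sum = 2 ^ l)
    (hbary : (M.map fun x => (2 : ℝ) ^ x.2 • x.1).sum = (2 : ℝ) ^ l • b) :
    ∃ B : Finset (Fin d → ℝ), IsMediatedSet {p | ∃ x ∈ M, x.1 = p} B ∧ B.card + 1 ≤ n ∧
      (b ∈ B ∨ ∀ x ∈ M, x.1 = b) := by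
  classical
  induction n generalizing M with
  | zero =>
    obtain rfl := Multiset.card_eq_zero.1 hn
    simp at hsum
    exact absurd hsum.symm (by positivity)
  | succ n ih =>
    by_cases hone : M.card = 1
    · obtain ⟨⟨p, e⟩, rfl⟩ := Multiset.card_eq_one.1 hone
      have he : e = l := by simpa using hsum
      subst he
      have hp : p = b := by
        simp only [Multiset.map_singleton, Multiset.sum_singleton] at hbary
        exact smul_right_injective _ (by positivity : (2 : ℝ) ^ e ≠ 0) hbary
      exact ⟨∅, by simp [IsMediatedSet], by simp, Or.inr (by simpa using hp)⟩
    · obtain ⟨e, t, ht⟩ := exists_eq_cons_cons_of_sum_two_pow (E := M.map Prod.snd) (l := l)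
        (by simpa [Multiset.map_map, Function.comp_def] using hsum) (by simpa using hone)
      obtain ⟨⟨p, e₁⟩, hpM, rfl, ht⟩ := (Multiset.map_eq_cons _ _ _ _).2 ht
      obtain ⟨⟨q, e₂⟩, hqM, he, ht⟩ := (Multiset.map_eq_cons _ _ _ _).2 ht
      obtain ⟨M₁, rfl⟩ := Multiset.exists_cons_of_mem hpM
      rw [Multiset.erase_cons_head] at hqM ht
      obtain ⟨T, rfl⟩ := Multiset.exists_cons_of_mem hqM
      dsimp only at he
      subst he
      clear ht hpM hqM hone
      set r : Fin d → ℝ := (2 : ℝ)⁻¹ • (p + q) with hr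
      have hr2 : (2 : ℝ) • r = p + q := by rw [hr, smul_inv_smul₀ two_ne_zero]
      obtain ⟨B, hB, hcard, hb⟩ := ih ((r, e₂ + 1) ::ₘ T) (by simpa using hn)
        (by
          rw [← hsum]
          simp only [Multiset.map_cons, Multiset.sum_cons]
          ring)
        (by
          rw [← hbary]
          simp only [Multiset.map_cons, Multiset.sum_cons]
          rw [pow_succ, mul_smul, hr2, smul_add, add_assoc])
      by_cases hpq : p = q
      · have hrp : r = p := by
          apply smul_right_injective _ (two_ne_zero (α := ℝ))
          simp only [hr2, ← hpq, two_smul]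
        have hsub : ∀ y ∈ {y | ∃ x ∈ (r, e₂ + 1) ::ₘ T, x.1 = y} ∪ (B : Set (Fin d → ℝ)),
            y ∈ {y | ∃ x ∈ (p, e₂) ::ₘ (q, e₂) ::ₘ T, x.1 = y} ∪ (B : Set (Fin d → ℝ)) := by
          rintro y (⟨x, hx, rfl⟩ | hy)
          · rcases Multiset.mem_cons.1 hx with rfl | hx
            · exact Or.inl ⟨(p, e₂), by simp, hrp.symm⟩
            · exact Or.inl ⟨x, by simp [hx], rfl⟩
          · exact Or.inr hy
        refine ⟨B, ?_, by omega, hb.imp_right fun h x hx => ?_⟩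
        · intro y hy
          obtain ⟨γ, hγ, δ, hδ, h⟩ := hB y hy
          exact ⟨γ, hsub γ hγ, δ, hsub δ hδ, h⟩
        · have hrb : r = b := h (r, e₂ + 1) (by simp)
          simp only [Multiset.mem_cons] at hx
          rcases hx with rfl | rfl | hx
          · exact hrp.symm.trans hrb
          · exact hpq.symm.trans (hrp.symm.trans hrb)
          · exact h x (by simp [hx])
      · have hsub : ∀ y ∈ {y | ∃ x ∈ (r, e₂ + 1) ::ₘ T, x.1 = y} ∪ (B : Set (Fin d → ℝ)),
            y ∈ {y | ∃ x ∈ (p, e₂) ::ₘ (q, e₂) ::ₘ T, x.1 = y} ∪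
              ((insert r B : Finset (Fin d → ℝ)) : Set (Fin d → ℝ)) := by
          rintro y (⟨x, hx, rfl⟩ | hy)
          · rcases Multiset.mem_cons.1 hx with rfl | hx
            · exact Or.inr (by simp)
            · exact Or.inl ⟨x, by simp [hx], rfl⟩
          · exact Or.inr (Finset.mem_coe.2 (Finset.mem_insert_of_mem hy))
        refine ⟨insert r B, ?_, ?_, Or.inl ?_⟩
        · intro y hy
          rcases Finset.mem_insert.1 hy with rfl | hy
          · exact ⟨p, Or.inl ⟨(p, e₂), by simp, rfl⟩, q, Or.inl ⟨(q, e₂), by simp, rfl⟩, hpq, hr2⟩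
          · obtain ⟨γ, hγ, δ, hδ, h⟩ := hB y hy
            exact ⟨γ, hsub γ hγ, δ, hsub δ hδ, h⟩
        · have := Finset.card_insert_le r B
          omega
        · rcases hb with hb | hb
          · exact Finset.mem_insert_of_mem hb
          · exact Finset.mem_insert.2 (Or.inl (hb (r, e₂ + 1) (by simp)).symm)

/-- There exists an `(𝒜, β)`-mediated set of cardinality at most
`∑ᵢ ω(sᵢ) + ω(2^l - ŝ) - 1` where `ω` is the number of ones in the binary expansion
and `l = ⌈log₂ ŝ⌉` (the greedy-common-one bound). -/
theorem exists_mediated_card_le_binaryWeight {m : ℕ} (hm : 2 ≤ m)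
    (α : Fin m → (Fin (m - 1) → ℝ)) (hα : AffineIndependent ℝ α)
    (s : Fin m → ℕ) (hs : ∀ i, 0 < s i) (hgcd : Finset.univ.gcd s = 1)
    (l : ℕ) (hl : l = Nat.clog 2 (∑ i, s i))
    (β : Fin (m - 1) → ℝ)
    (hβ : β = ((∑ i, s i : ℕ) : ℝ)⁻¹ • ∑ i, (s i : ℝ) • α i) :
    ∃ B : Finset (Fin (m - 1) → ℝ), IsMediatedSet (Set.range α) B ∧ β ∈ B ∧
      B.card ≤ (∑ i, binaryWeight (s i)) + binaryWeight (2 ^ l - ∑ i, s i) - 1 := by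
  have hle : ∑ i, s i ≤ 2 ^ l := hl ▸ Nat.le_pow_clog one_lt_two _
  have hpos : 0 < ∑ i, s i :=
    Finset.sum_pos (fun i _ => hs i) ⟨⟨0, by omega⟩, Finset.mem_univ _⟩
  have hβ' : ((∑ i, s i : ℕ) : ℝ) • β = ∑ i, (s i : ℝ) • α i := by
    rw [hβ, smul_inv_smul₀ (by exact_mod_cast hpos.ne')]
  choose E hEcard hEsum using exists_multiset_card_eq_binaryWeight
  have hpoint (n : ℕ) (p : Fin (m - 1) → ℝ) :
      ((E n).map fun e => (2 : ℝ) ^ e • p).sum = (n : ℝ) • p := by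
    have hcast : (n : ℝ) = ((E n).map fun e => (2 : ℝ) ^ e).sum := by
      conv_lhs => rw [← hEsum n]
      simp [Nat.cast_multiset_sum, Multiset.map_map]
    rw [hcast, Multiset.sum_smul, Multiset.map_map]
    rfl
  set M : Multiset ((Fin (m - 1) → ℝ) × ℕ) :=
    (∑ i, (E (s i)).map fun e => (α i, e)) + (E (2 ^ l - ∑ i, s i)).map fun e => (β, e) with hM
  have hmapsum {X : Type} [AddCommMonoid X] (f : (Fin (m - 1) → ℝ) × ℕ → X) :
      (M.map f).sum = (∑ i, ((E (s i)).map fun e => f (α i, e)).sum) +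
        ((E (2 ^ l - ∑ i, s i)).map fun e => f (β, e)).sum := by
    rw [hM, Multiset.map_add, Multiset.sum_add, ← Multiset.coe_mapAddMonoidHom, map_sum,
      ← Multiset.coe_sumAddMonoidHom, map_sum]
    simp [Multiset.map_map]
  have hmem (x) (hx : x ∈ M) : x.1 ∈ Set.range α ∨ x.1 = β := by
    rw [hM, Multiset.mem_add, Multiset.mem_sum] at hx
    rcases hx with ⟨i, -, hx⟩ | hx
    · obtain ⟨e, -, rfl⟩ := Multiset.mem_map.1 hx
      exact Or.inl ⟨i, rfl⟩
    · obtain ⟨e, -, rfl⟩ := Multiset.mem_map.1 hx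
      exact Or.inr rfl
  obtain ⟨B, hB, hcard, hb⟩ := exists_mediated_of_dyadic_weights l β
    ((∑ i, binaryWeight (s i)) + binaryWeight (2 ^ l - ∑ i, s i)) M
    (by simp [hM, hEcard])
    (by
      rw [hmapsum]
      simp only [hEsum]
      omega)
    (by
      rw [hmapsum]
      simp only [hpoint]
      rw [← hβ', ← add_smul, ← Nat.cast_add, Nat.add_sub_cancel' hle]
      simp)
  have hβB : β ∈ B := by
    refine hb.resolve_right fun hall => ?_
    have hαβ (i : Fin m) : α i = β := by
      have hne : E (s i) ≠ 0 := by
        intro h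
        have := hEsum (s i)
        rw [h] at this
        exact (hs i).ne (by simpa using this)
      obtain ⟨e, he⟩ := Multiset.exists_mem_of_ne_zero hne
      refine hall (α i, e) ?_
      rw [hM, Multiset.mem_add, Multiset.mem_sum]
      exact Or.inl ⟨i, Finset.mem_univ _, Multiset.mem_map.2 ⟨e, he, rfl⟩⟩
    have h01 := hα.injective ((hαβ ⟨0, by omega⟩).trans (hαβ ⟨1, by omega⟩).symm)
    simp at h01
  have hsub (y) (hy : y ∈ {p | ∃ x ∈ M, x.1 = p} ∪ (B : Set (Fin (m - 1) → ℝ))) :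
      y ∈ Set.range α ∪ (B : Set (Fin (m - 1) → ℝ)) := by
    rcases hy with ⟨x, hx, rfl⟩ | hy
    · rcases hmem x hx with h | h
      · exact Or.inl h
      · exact Or.inr (h ▸ hβB)
    · exact Or.inr hy
  refine ⟨B, fun y hy => ?_, hβB, by omega⟩
  obtain ⟨γ, hγ, δ, hδ, h⟩ := hB y hy
  exact ⟨γ, hsub γ hγ, δ, hsub δ hδ, h⟩
end

section
/- Let m ≥ 2, let α_1, …, α_m be a trellis in ℝ^{m−1}, let s_1, …, s_m be positive integers with gcd(s_1,…,s_m) = 1, set ŝ = s_1 + ⋯ + s_m, l = ⌈log₂ ŝ⌉, and β = (1/ŝ)·∑_{i=1}^m s_i·α_i. Then there exists a finite (𝒜,β)-mediated set B ⊆ ℝ^{m−1} such that 2·|B| ≤ ∑_{i=1}^m (l − ν₂(s_i)) + (l − Δ(2^l − ŝ)), where ν₂(r) denotes the 2-adic valuation of r, and Δ(r) = ν₂(r) for r > 0 while Δ(0) = l. -/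
/-- The cost `l - ν₂(n)` of a positive weight `n`; the weight `0` costs nothing. -/
def dyadicCost (l n : ℕ) : ℕ := if n = 0 then 0 else l - padicValNat 2 n

@[simp]
theorem dyadicCost_zero (l : ℕ) : dyadicCost l 0 = 0 := by simp [dyadicCost]

theorem dyadicCost_le_of_dvd (l : ℕ) {k n : ℕ} (h : 2 ^ k ∣ n) : dyadicCost l n ≤ l - k := by
  rcases eq_or_ne n 0 with rfl | hn
  · simp
  · have := (padicValNat_dvd_iff_le hn).1 h
    rw [dyadicCost, if_neg hn]
    omega

theorem dyadicCost_add_le (l a b : ℕ) :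
    dyadicCost l (a + b) ≤ dyadicCost l a + dyadicCost l b := by
  rcases eq_or_ne a 0 with rfl | ha
  · simp
  rcases eq_or_ne b 0 with rfl | hb
  · simp
  have h : 2 ^ min (padicValNat 2 a) (padicValNat 2 b) ∣ a + b :=
    dvd_add ((pow_dvd_pow 2 (min_le_left _ _)).trans pow_padicValNat_dvd)
      ((pow_dvd_pow 2 (min_le_right _ _)).trans pow_padicValNat_dvd)
  have h' := dyadicCost_le_of_dvd l h
  simp only [dyadicCost, if_neg ha, if_neg hb] at h' ⊢
  omega

/-- The total cost of a finitely supported weight function. -/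
def dyadicPotential {V : Type*} (l : ℕ) (t : V →₀ ℕ) : ℕ := t.sum fun _ n => dyadicCost l n

@[simp]
theorem dyadicPotential_single {V : Type*} (l : ℕ) (p : V) (a : ℕ) :
    dyadicPotential l (Finsupp.single p a) = dyadicCost l a := by
  simp [dyadicPotential]

theorem dyadicPotential_add_le {V : Type*} (l : ℕ) (t u : V →₀ ℕ) :
    dyadicPotential l (t + u) ≤ dyadicPotential l t + dyadicPotential l u := by
  classical
  unfold dyadicPotential
  rw [Finsupp.sum_of_support_subset _ Finsupp.support_add _ (by simp),
    Finsupp.sum_of_support_subset t (Finset.subset_union_left (s₂ := u.support)) _ (by simp),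
    Finsupp.sum_of_support_subset u (Finset.subset_union_right (s₁ := t.support)) _ (by simp),
    ← Finset.sum_add_distrib]
  exact Finset.sum_le_sum fun p _ => dyadicCost_add_le l _ _

theorem dyadicPotential_sum_le {V ι : Type*} (l : ℕ) (S : Finset ι) (f : ι → V →₀ ℕ) :
    dyadicPotential l (∑ i ∈ S, f i) ≤ ∑ i ∈ S, dyadicPotential l (f i) :=
  Finset.le_sum_of_subadditive _ (by simp [dyadicPotential]) (dyadicPotential_add_le l) S f

/-- Among weights with sum `2 ^ l`, not all at one point, two points share the minimal
2-adic valuation. -/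
theorem exists_ne_padicValNat_eq {V : Type*} {l : ℕ} {t : V →₀ ℕ} (ht : t.degree = 2 ^ l)
    (hnt : (t.support : Set V).Nontrivial) :
    ∃ p ∈ t.support, ∃ q ∈ t.support, p ≠ q ∧ padicValNat 2 (t p) = padicValNat 2 (t q) ∧
      padicValNat 2 (t p) < l := by
  classical
  obtain ⟨p, hp, hmin⟩ := Finset.exists_min_image t.support (fun p => padicValNat 2 (t p))
    (Finset.coe_nonempty.1 hnt.nonempty)
  have hp0 : t p ≠ 0 := Finsupp.mem_support_iff.1 hp
  have hlt : padicValNat 2 (t p) < l := by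
    obtain ⟨q, hq, hqp⟩ := hnt.exists_ne p
    have hq0 : t q ≠ 0 := Finsupp.mem_support_iff.1 hq
    have h1 : t p + t q ≤ 2 ^ l := by
      rw [← ht, Finsupp.degree_apply, ← Finset.sum_pair hqp.symm]
      refine Finset.sum_le_sum_of_subset fun x hx => ?_
      rcases Finset.mem_insert.1 hx with rfl | hx
      · exact hp
      · rw [Finset.mem_singleton.1 hx]
        exact hq
    have h2 : 2 ^ padicValNat 2 (t p) ≤ t p :=
      Nat.le_of_dvd (Nat.pos_of_ne_zero hp0) pow_padicValNat_dvd
    exact (Nat.pow_lt_pow_iff_right one_lt_two).1 (by omega)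
  by_contra! hcon
  have hdvd : ∀ q ∈ t.support.erase p, 2 ^ (padicValNat 2 (t p) + 1) ∣ t q := by
    intro q hq
    obtain ⟨hqp, hq⟩ := Finset.mem_erase.1 hq
    refine (padicValNat_dvd_iff_le (Finsupp.mem_support_iff.1 hq)).2 ?_
    have h1 := hmin q hq
    have h2 : padicValNat 2 (t p) ≠ padicValNat 2 (t q) := fun h =>
      absurd hlt (not_lt.2 (hcon p hp q hq hqp.symm h))
    omega
  have hsum : t p + ∑ q ∈ t.support.erase p, t q = 2 ^ l := by
    rw [Finset.add_sum_erase _ _ hp, ← ht, Finsupp.degree_apply]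
  have : 2 ^ (padicValNat 2 (t p) + 1) ∣ t p :=
    (Nat.dvd_add_left (Finset.dvd_sum hdvd)).1 (hsum ▸ pow_dvd_pow 2 hlt)
  exact pow_succ_padicValNat_not_dvd hp0 this

/-- Replacing the weights `a ≤ b` of equal valuation `< l` by `2 * a` and `b - a` lowers the
cost by at least two. -/
theorem dyadicCost_two_mul_add_sub_le {l a b : ℕ} (ha : a ≠ 0) (hab : a ≤ b)
    (hv : padicValNat 2 a = padicValNat 2 b) (hl : padicValNat 2 a < l) :
    dyadicCost l (2 * a) + dyadicCost l (b - a) + 2 ≤ dyadicCost l a + dyadicCost l b := by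
  have hb : b ≠ 0 := by omega
  have h1 : dyadicCost l (2 * a) ≤ l - (padicValNat 2 a + 1) :=
    dyadicCost_le_of_dvd l (by
      rw [pow_succ']
      exact mul_dvd_mul_left 2 pow_padicValNat_dvd)
  have h2 : dyadicCost l (b - a) ≤ l - (padicValNat 2 a + 1) := by
    apply dyadicCost_le_of_dvd
    obtain ⟨c, hc⟩ : 2 ^ padicValNat 2 a ∣ a := pow_padicValNat_dvd
    obtain ⟨d, hd⟩ : 2 ^ padicValNat 2 a ∣ b := by
      rw [hv]
      exact pow_padicValNat_dvd
    have hc2 : ¬ 2 ∣ c := fun h => pow_succ_padicValNat_not_dvd (p := 2) ha (by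
      conv_rhs => rw [hc]
      rw [pow_succ]
      exact mul_dvd_mul_left _ h)
    have hd2 : ¬ 2 ∣ d := fun h => pow_succ_padicValNat_not_dvd (p := 2) hb (by
      rw [← hv]
      conv_rhs => rw [hd]
      rw [pow_succ]
      exact mul_dvd_mul_left _ h)
    have hsub : b - a = 2 ^ padicValNat 2 a * (d - c) := by
      rw [Nat.mul_sub, ← hc, ← hd]
    rw [hsub, pow_succ]
    exact mul_dvd_mul_left _ (by omega)
  simp only [dyadicCost, if_neg ha, if_neg hb] at h1 h2 ⊢
  omega

/-- If weights with sum `2 ^ l` are not concentrated at one point, their barycenter lies in a set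
of iterated midpoints whose size is at most half the potential. -/
theorem exists_midpoints_two_mul_card_le {V : Type*} [AddCommGroup V] [Module ℝ V]
    (l : ℕ) (β : V) (t : V →₀ ℕ) (ht : t.degree = 2 ^ l)
    (hβ : Finsupp.linearCombination ℕ id t = 2 ^ l • β) :
    ∃ B : Finset V,
      (∀ b ∈ B, ∃ γ ∈ (t.support : Set V) ∪ ↑B, ∃ δ ∈ (t.support : Set V) ∪ ↑B,
        γ ≠ δ ∧ (2 : ℝ) • b = γ + δ) ∧
      ((t.support : Set V).Nontrivial → β ∈ B) ∧ 2 * B.card ≤ dyadicPotential l t := by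
  classical
  induction hn : dyadicPotential l t using Nat.strong_induction_on generalizing t with
  | _ n ih =>
  subst hn
  by_cases hnt : (t.support : Set V).Nontrivial
  swap
  · exact ⟨∅, by simp, fun h => absurd h hnt, by simp⟩
  obtain ⟨p, hp, q, hq, hpq, hv, hvl, hle⟩ : ∃ p ∈ t.support, ∃ q ∈ t.support, p ≠ q ∧
      padicValNat 2 (t p) = padicValNat 2 (t q) ∧ padicValNat 2 (t p) < l ∧ t p ≤ t q := by
    obtain ⟨p, hp, q, hq, hpq, hv, hvl⟩ := exists_ne_padicValNat_eq ht hnt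
    rcases le_total (t p) (t q) with h | h
    · exact ⟨p, hp, q, hq, hpq, hv, hvl, h⟩
    · exact ⟨q, hq, p, hp, hpq.symm, hv.symm, hv ▸ hvl, h⟩
  have hp0 : t p ≠ 0 := Finsupp.mem_support_iff.1 hp
  have hq' : q ∈ (t.erase p).support := by simp [hpq.symm, Finsupp.mem_support_iff.1 hq]
  have hqe : t.erase p q = t q := Finsupp.erase_ne hpq.symm
  set r := (t.erase p).erase q with hr
  set y : V := (2 : ℝ)⁻¹ • (p + q) with hy
  have h2y : (2 : ℝ) • y = p + q := by rw [hy, smul_inv_smul₀ two_ne_zero]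
  have htr : t = Finsupp.single p (t p) + (Finsupp.single q (t q) + r) := by
    rw [← hqe, hr, Finsupp.single_add_erase, Finsupp.single_add_erase]
  have hpot : dyadicPotential l t =
      dyadicCost l (t p) + (dyadicCost l (t q) + dyadicPotential l r) := by
    unfold dyadicPotential
    rw [← Finsupp.add_sum_erase t p _ hp, ← Finsupp.add_sum_erase _ q _ hq', hqe]
  set t' := Finsupp.single y (2 * t p) + (Finsupp.single q (t q - t p) + r) with ht'
  have hpot' : dyadicPotential l t' + 2 ≤ dyadicPotential l t := by
    have h1 := dyadicPotential_add_le l (Finsupp.single y (2 * t p))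
      (Finsupp.single q (t q - t p) + r)
    have h2 := dyadicPotential_add_le l (Finsupp.single q (t q - t p)) r
    have h3 := dyadicCost_two_mul_add_sub_le hp0 hle hv hvl
    rw [dyadicPotential_single] at h1 h2
    rw [← ht'] at h1
    omega
  have hdeg' : t'.degree = 2 ^ l := by
    rw [htr] at ht
    simp only [map_add, Finsupp.degree_single] at ht
    simp only [ht', map_add, Finsupp.degree_single]
    omega
  have hβ' : Finsupp.linearCombination ℕ id t' = 2 ^ l • β := by
    rw [← hβ]
    conv_rhs => rw [htr]
    simp only [ht', map_add, Finsupp.linearCombination_single, id]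
    obtain ⟨c, hc⟩ := Nat.exists_eq_add_of_le hle
    have h2y' : 2 • y = p + q := by
      rw [← h2y, ofNat_smul_eq_nsmul ℝ 2 y]
    rw [hc, Nat.add_sub_cancel_left, mul_comm, mul_smul, h2y', smul_add, add_smul]
    abel
  have hsupp : ∀ x ∈ t'.support, x = y ∨ x ∈ t.support := by
    intro x hx
    by_contra! hcon
    have hxq : q ≠ x := fun h => hcon.2 (h ▸ hq)
    refine Finsupp.mem_support_iff.1 hx ?_
    have hx0 : t x = 0 := Finsupp.notMem_support_iff.1 hcon.2
    simp [ht', hr, Finsupp.erase, hcon.1.symm, hxq, hx0]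
  obtain ⟨B, hB, hBβ, hcard⟩ := ih _ (by omega) t' hdeg' hβ' rfl
  have hsub : ∀ x ∈ (t'.support : Set V) ∪ ↑B, x ∈ (t.support : Set V) ∪ ↑(insert y B) := by
    rintro x (hx | hx)
    · rcases hsupp x hx with rfl | hx
      · exact Or.inr (by simp)
      · exact Or.inl hx
    · exact Or.inr (Finset.mem_insert_of_mem hx)
  refine ⟨insert y B, ?_, fun _ => ?_, ?_⟩
  · intro b hb
    rcases Finset.mem_insert.1 hb with rfl | hb
    · exact ⟨p, Or.inl hp, q, Or.inl hq, hpq, h2y⟩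
    · obtain ⟨γ, hγ, δ, hδ, h⟩ := hB b hb
      exact ⟨γ, hsub γ hγ, δ, hsub δ hδ, h⟩
  · by_cases hnt' : (t'.support : Set V).Nontrivial
    · exact Finset.mem_insert_of_mem (hBβ hnt')
    · have hys : y ∈ t'.support := by simp [ht', hp0]
      have hsingle : t' = Finsupp.single y (t' y) := by
        refine Finsupp.support_subset_singleton.1 fun x hx => ?_
        rw [Finset.mem_singleton]
        exact Set.not_nontrivial_iff.1 hnt' hx hys
      rw [hsingle, Finsupp.degree_single] at hdeg'
      rw [hsingle, hdeg', Finsupp.linearCombination_single, id] at hβ'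
      have hyβ : y = β := by
        refine smul_right_injective V (r := (2 : ℝ) ^ l) (by positivity) ?_
        have := hβ'
        rw [← Nat.cast_smul_eq_nsmul ℝ, ← Nat.cast_smul_eq_nsmul ℝ] at this
        simpa using this
      simp [hyβ]
  · have := Finset.card_insert_le y B
    omega

/-- There exists an `(𝒜, β)`-mediated set `B` with
`2 * |B| ≤ ∑ᵢ (l - ν₂(sᵢ)) + (l - Δ(2^l - ŝ))`, where `l = ⌈log₂ ŝ⌉`, `ν₂` is the
2-adic valuation, and `Δ(r) = ν₂(r)` for `r > 0` while `Δ(0) = l`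
(the greedy-power-two bound). -/
theorem exists_mediated_two_mul_card_le {m : ℕ} (hm : 2 ≤ m)
    (α : Fin m → (Fin (m - 1) → ℝ)) (hα : AffineIndependent ℝ α)
    (s : Fin m → ℕ) (hs : ∀ i, 0 < s i) (hgcd : Finset.univ.gcd s = 1)
    (l : ℕ) (hl : l = Nat.clog 2 (∑ i, s i))
    (β : Fin (m - 1) → ℝ)
    (hβ : β = ((∑ i, s i : ℕ) : ℝ)⁻¹ • ∑ i, (s i : ℝ) • α i) :
    ∃ B : Finset (Fin (m - 1) → ℝ), IsMediatedSet (Set.range α) B ∧ β ∈ B ∧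
      2 * B.card ≤ (∑ i, (l - padicValNat 2 (s i))) +
        (l - (if 2 ^ l - ∑ i, s i = 0 then l
              else padicValNat 2 (2 ^ l - ∑ i, s i))) := by
  classical
  have hle : ∑ i, s i ≤ 2 ^ l := hl ▸ Nat.le_pow_clog one_lt_two _
  have hpos : ∑ i, s i ≠ 0 := by
    have := Finset.single_le_sum (f := s) (fun i _ => Nat.zero_le _)
      (Finset.mem_univ (⟨0, by omega⟩ : Fin m))
    have := hs ⟨0, by omega⟩
    omega
  have hsum : ∑ i, s i • α i = (∑ i, s i) • β := by
    rw [hβ, ← Nat.cast_smul_eq_nsmul ℝ, smul_inv_smul₀ (Nat.cast_ne_zero.2 hpos)]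
    exact Finset.sum_congr rfl fun i _ => (Nat.cast_smul_eq_nsmul ℝ _ _).symm
  set c := 2 ^ l - ∑ i, s i with hc
  set t : (Fin (m - 1) → ℝ) →₀ ℕ :=
    Finsupp.single β c + ∑ i, Finsupp.single (α i) (s i) with ht
  have hdeg : t.degree = 2 ^ l := by
    simp only [ht, map_add, map_sum, Finsupp.degree_single]
    omega
  have hlin : Finsupp.linearCombination ℕ id t = 2 ^ l • β := by
    simp only [ht, map_add, map_sum, Finsupp.linearCombination_single, id]
    rw [hsum, ← add_smul, hc, Nat.sub_add_cancel hle]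
  have hmem : ∀ i, α i ∈ t.support := by
    intro i
    have h1 : s i ≤ (∑ j, Finsupp.single (α j) (s j)) (α i) := by
      rw [Finsupp.finsetSum_apply]
      simpa using Finset.single_le_sum (f := fun j => Finsupp.single (α j) (s j) (α i))
        (fun j _ => Nat.zero_le _) (Finset.mem_univ i)
    have h2 := hs i
    rw [Finsupp.mem_support_iff, ht, Finsupp.add_apply]
    omega
  have hsupp : ∀ x ∈ t.support, x = β ∨ x ∈ Set.range α := by
    intro x hx
    by_contra! hcon
    refine Finsupp.mem_support_iff.1 hx ?_
    have hne : ∀ i, α i ≠ x := fun i h => hcon.2 ⟨i, h⟩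
    simp [ht, hcon.1.symm, hne]
  have hnt : (t.support : Set (Fin (m - 1) → ℝ)).Nontrivial :=
    ⟨_, hmem ⟨0, by omega⟩, _, hmem ⟨1, by omega⟩, fun h => by simpa using hα.injective h⟩
  have hpot : dyadicPotential l t ≤ dyadicCost l c + ∑ i, dyadicCost l (s i) := by
    refine (dyadicPotential_add_le l _ _).trans ?_
    simpa using dyadicPotential_sum_le l Finset.univ fun i => Finsupp.single (α i) (s i)
  obtain ⟨B, hB, hβB, hcard⟩ := exists_midpoints_two_mul_card_le l β t hdeg hlin
  have hβB := hβB hnt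
  have hsub : ∀ x ∈ (t.support : Set (Fin (m - 1) → ℝ)) ∪ ↑B, x ∈ Set.range α ∪ ↑B := by
    rintro x (hx | hx)
    · rcases hsupp x hx with rfl | hx
      · exact Or.inr hβB
      · exact Or.inl hx
    · exact Or.inr hx
  refine ⟨B, fun b hb => ?_, hβB, ?_⟩
  · obtain ⟨γ, hγ, δ, hδ, h⟩ := hB b hb
    exact ⟨γ, hsub γ hγ, δ, hsub δ hδ, h⟩
  · have h1 : ∑ i, dyadicCost l (s i) = ∑ i, (l - padicValNat 2 (s i)) :=
      Finset.sum_congr rfl fun i _ => if_neg (hs i).ne'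
    have h2 : dyadicCost l c = l - (if c = 0 then l else padicValNat 2 c) := by
      unfold dyadicCost
      split_ifs <;> simp
    omega
end

section
/- Let m ≥ 2, let α_1, …, α_m be a trellis in ℝ^{m−1}, and let β = ∑_{i=1}^m λ_i·α_i where λ_1, …, λ_m are real numbers with ∑_{i=1}^m λ_i = 1. If there exists a finite (𝒜,β)-mediated set, then every λ_i is a rational number. -/
/-- A finite set of points in `ℝᵈ` each of which is the average of two distinct points of the set
is empty. -/
theorem Finset.eq_empty_of_forall_exists_midpoint {d : ℕ} (S : Finset (Fin d → ℝ))
    (h : ∀ x ∈ S, ∃ y ∈ S, ∃ z ∈ S, y ≠ z ∧ (2 : ℝ) • x = y + z) : S = ∅ := by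
  by_contra hS
  obtain ⟨x, hx, hmax⟩ := S.exists_max_image (fun v => ∑ i, v i ^ 2)
    (Finset.nonempty_iff_ne_empty.2 hS)
  obtain ⟨y, hy, z, hz, hne, hxyz⟩ := h x hx
  have hpos : 0 < ∑ i, (y i - z i) ^ 2 := by
    obtain ⟨j, hj⟩ := Function.ne_iff.1 hne
    exact Finset.sum_pos' (fun i _ => sq_nonneg _)
      ⟨j, Finset.mem_univ j, sq_pos_of_ne_zero (sub_ne_zero.2 hj)⟩
  have hparallelogram : 4 * ∑ i, x i ^ 2 + ∑ i, (y i - z i) ^ 2 =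
      2 * ∑ i, y i ^ 2 + 2 * ∑ i, z i ^ 2 := by
    simp only [Finset.mul_sum, ← Finset.sum_add_distrib]
    refine Finset.sum_congr rfl fun i _ => ?_
    have hi : 2 * x i = y i + z i := by simpa using congrFun hxyz i
    linear_combination (2 * x i + y i + z i) * hi
  linarith [hmax y hy, hmax z hz]

/-- Maximum principle for mediated sets: a function that respects averages and is nonpositive on
`A` is nonpositive on every `A`-mediated set. -/
theorem IsMediatedSet.apply_nonpos {d : ℕ} {A : Set (Fin d → ℝ)} {B : Finset (Fin d → ℝ)}
    (hB : IsMediatedSet A B) (g : (Fin d → ℝ) → ℚ)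
    (hg : ∀ x y z : Fin d → ℝ, (2 : ℝ) • x = y + z → 2 * g x = g y + g z)
    (hA : ∀ a ∈ A, g a ≤ 0) : ∀ b ∈ B, g b ≤ 0 := by
  intro b hb
  by_contra! hpos
  obtain ⟨x, hx, hmax⟩ := B.exists_max_image g ⟨b, hb⟩
  have hx0 : 0 < g x := hpos.trans_le (hmax b hb)
  have hle : ∀ y ∈ A ∪ ↑B, g y ≤ g x := by
    rintro y (hy | hy)
    · exact (hA y hy).trans hx0.le
    · exact hmax y hy
  have hmem : ∀ y ∈ A ∪ ↑B, g y = g x → y ∈ B.filter (g · = g x) := by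
    rintro y (hy | hy) hyx
    · linarith [hA y hy]
    · exact Finset.mem_filter.2 ⟨hy, hyx⟩
  have hempty := (B.filter (g · = g x)).eq_empty_of_forall_exists_midpoint fun u hu => by
    obtain ⟨huB, hux⟩ := Finset.mem_filter.1 hu
    obtain ⟨y, hy, z, hz, hne, huyz⟩ := hB u huB
    have := hg u y z huyz
    have := hle y hy
    have := hle z hz
    exact ⟨y, hmem y hy (by linarith), z, hmem z hz (by linarith), hne, huyz⟩
  exact Finset.notMem_empty x (hempty ▸ Finset.mem_filter.2 ⟨hx, rfl⟩)

/-- An irrational number is sent to a positive number by some `ℚ`-linear functional on `ℝ`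
that vanishes at `1`. -/
theorem Irrational.exists_linearMap_pos {x : ℝ} (hx : Irrational x) :
    ∃ f : ℝ →ₗ[ℚ] ℚ, f 1 = 0 ∧ 0 < f x := by
  have hmem : x ∉ Submodule.span ℚ {(1 : ℝ)} := by
    rw [Submodule.mem_span_singleton]
    rintro ⟨q, rfl⟩
    exact hx ⟨q, by simp [Rat.smul_def]⟩
  obtain ⟨f, hfx, hf⟩ := Submodule.exists_le_ker_of_notMem hmem
  have hf1 : f 1 = 0 := hf (Submodule.mem_span_singleton_self 1)
  rcases lt_or_gt_of_ne hfx with h | h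
  · exact ⟨-f, by simp [hf1], by simpa using h⟩
  · exact ⟨f, hf1, h⟩

/-- If `β = ∑ᵢ λᵢ • αᵢ` with `∑ᵢ λᵢ = 1` for a trellis `α₁, …, α_m`, and there exists a
finite `(𝒜, β)`-mediated set, then every barycentric coordinate `λᵢ` is rational. -/
theorem mediated_barycentric_rational {m : ℕ} (hm : 2 ≤ m)
    (α : Fin m → (Fin (m - 1) → ℝ)) (hα : AffineIndependent ℝ α)
    (lam : Fin m → ℝ) (hsum : ∑ i, lam i = 1)
    (β : Fin (m - 1) → ℝ) (hβ : β = ∑ i, lam i • α i)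
    (hexists : ∃ B : Finset (Fin (m - 1) → ℝ),
      IsMediatedSet (Set.range α) B ∧ β ∈ B) :
    ∀ i, ∃ q : ℚ, lam i = (q : ℝ) := by
  intro i
  obtain ⟨B, hB, hβB⟩ := hexists
  by_contra hrat
  have hirr : Irrational (lam i) := fun ⟨q, hq⟩ => hrat ⟨q, hq.symm⟩
  obtain ⟨f, hf1, hfpos⟩ := hirr.exists_linearMap_pos
  have hspan : affineSpan ℝ (Set.range α) = ⊤ := by
    rw [hα.affineSpan_eq_top_iff_card_eq_finrank_add_one]
    simp
    omega
  let b : AffineBasis (Fin m) ℝ (Fin (m - 1) → ℝ) := ⟨α, hα, hspan⟩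
  have hcoord : b.coord i β = lam i := by
    rw [hβ, ← Finset.univ.affineCombination_eq_linear_combination α lam hsum]
    exact b.coord_apply_combination_of_mem (Finset.mem_univ i) hsum
  refine (hB.apply_nonpos (fun x => f (b.coord i x)) ?_ ?_ β hβB).not_gt (hcoord ▸ hfpos)
  · intro x y z hxyz
    have hx : x = midpoint ℝ y z := by
      rw [midpoint_eq_smul_add, ← hxyz, smul_smul]
      simp
    have hmid : b.coord i x + b.coord i x = b.coord i y + b.coord i z := by
      rw [hx, AffineMap.map_midpoint, midpoint_add_self]
    simpa [two_mul] using congrArg f hmid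
  · rintro _ ⟨j, rfl⟩
    have hj : b.coord i (α j) = if i = j then 1 else 0 := b.coord_apply i j
    simp only [hj]
    split_ifs <;> simp [hf1]
end
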